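/- arXiv:math/0111327 — 6 statements merged into one kernel-verified Lean document; each statement's English description precedes it below -/
import Mathlib

section
/- Let G be a torsion-free group which is not free and is generated by two elements. Suppose G acts simplicially, without inversions, and 2-acylindrically on a simplicial tree T having at least one edge, in such a way that G acts transitively on the vertices of T and transitively on the unordered edges of T. Then there exist a generating pair (g,h) of G, adjacent vertices x and y of T, and an integer n ≥ 1 with g^n ≠ 1, such that g·x = x, g^n·y = y, and either h·x = y or h·y = x. -/
/-- Two unordered edges, given by their endpoints, are in the same orbit of the `G`-action. -/
def SameEdgeOrbit (G : Type*) {V : Type*} [Group G] [MulAction G V] (u w x y : V) : Prop :=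
  ∃ g : G, (g • u = x ∧ g • w = y) ∨ (g • u = y ∧ g • w = x)

section Tree

variable {V : Type*} {T : SimpleGraph V}

/-- On a geodesic of a tree, a vertex is determined by its distance from the starting point. -/
theorem SimpleGraph.IsTree.eq_of_between (hT : T.IsTree) {p q u v : V}
    (hu : T.dist p u + T.dist u q = T.dist p q) (hv : T.dist p v + T.dist v q = T.dist p q)
    (h : T.dist p u = T.dist p v) : u = v := by
  have key : ∀ x : V, T.dist p x + T.dist x q = T.dist p q →
      ∃ W : T.Walk p q, W.IsPath ∧ W.getVert (T.dist p x) = x := by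
    intro x hx
    obtain ⟨A, hA⟩ := hT.connected.exists_walk_length_eq_dist p x
    obtain ⟨B, hB⟩ := hT.connected.exists_walk_length_eq_dist x q
    refine ⟨A.append B, SimpleGraph.Walk.isPath_of_length_eq_dist _ ?_, ?_⟩
    · rw [SimpleGraph.Walk.length_append, hA, hB, hx]
    · rw [SimpleGraph.Walk.getVert_append, if_neg (by omega), hA, Nat.sub_self,
        SimpleGraph.Walk.getVert_zero]
  obtain ⟨P, hP, hPu⟩ := key u hu
  obtain ⟨Q, hQ, hQv⟩ := key v hv
  have hPQ : P = Q := (hT.existsUnique_path p q).unique hP hQ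
  rw [← hPu, ← hQv, hPQ, h]

/-- The edge `(s, t)` lies on the geodesic from `p` to `q`, with `s` at distance `k` from `p`. -/
structure SimpleGraph.EdgeOn (T : SimpleGraph V) (p q : V) (k : ℕ) (s t : V) : Prop where
  adj : T.Adj s t
  dist_fst : T.dist p s = k
  dist_snd : T.dist p t = k + 1
  fst_dist : T.dist s q + k = T.dist p q
  snd_dist : T.dist t q + (k + 1) = T.dist p q

theorem SimpleGraph.IsTree.exists_edgeOn (hT : T.IsTree) (p q : V) {k : ℕ}
    (hk : k < T.dist p q) : ∃ s t, T.EdgeOn p q k s t := by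
  obtain ⟨W, hW⟩ := hT.connected.exists_walk_length_eq_dist p q
  have h1 : ∀ i, i ≤ T.dist p q → T.dist p (W.getVert i) ≤ i := by
    intro i hi
    have := SimpleGraph.dist_le (W.take i)
    rw [SimpleGraph.Walk.take_length] at this
    omega
  have h2 : ∀ i, i ≤ T.dist p q → T.dist (W.getVert i) q ≤ T.dist p q - i := by
    intro i hi
    have := SimpleGraph.dist_le (W.drop i)
    rw [SimpleGraph.Walk.drop_length] at this
    omega
  have h3 := fun i => hT.connected.dist_triangle (u := p) (v := W.getVert i) (w := q)
  have := h1 k hk.le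
  have := h1 (k + 1) hk
  have := h2 k hk.le
  have := h2 (k + 1) hk
  have := h3 k
  have := h3 (k + 1)
  exact ⟨W.getVert k, W.getVert (k + 1), W.adj_getVert_succ (by omega), by omega, by omega,
    by omega, by omega⟩

theorem SimpleGraph.IsTree.exists_between (hT : T.IsTree) (p q : V) {k : ℕ}
    (hk : k ≤ T.dist p q) : ∃ x, T.dist p x = k ∧ T.dist x q + k = T.dist p q := by
  rcases hk.eq_or_lt with rfl | hlt
  · exact ⟨q, rfl, by simp⟩
  · obtain ⟨x, _, hx⟩ := hT.exists_edgeOn p q hlt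
    exact ⟨x, hx.dist_fst, hx.fst_dist⟩

/-- Vertices on a geodesic of a tree are linearly ordered. -/
theorem SimpleGraph.IsTree.between_of_dist_le (hT : T.IsTree) {p q u v : V}
    (hu : T.dist p u + T.dist u q = T.dist p q) (hv : T.dist p v + T.dist v q = T.dist p q)
    (h : T.dist p u ≤ T.dist p v) : T.dist p u + T.dist u v = T.dist p v := by
  obtain ⟨x, hx1, hx2⟩ := hT.exists_between p v h
  have a1 := hT.connected.dist_triangle (u := x) (v := v) (w := q)
  have a2 := hT.connected.dist_triangle (u := p) (v := x) (w := q)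
  obtain rfl : x = u := hT.eq_of_between (p := p) (q := q) (by omega) hu hx1
  omega

/-- In a tree, a path crossing an edge away from `p` and towards `w` is geodesic. -/
theorem SimpleGraph.IsTree.dist_eq_of_separating_edge (hT : T.IsTree) {p w s t : V}
    (hst : T.Adj s t) (hp : T.dist p t = T.dist p s + 1) (hw : T.dist s w = T.dist t w + 1) :
    T.dist p w = T.dist p t + T.dist t w := by
  obtain ⟨n, hn⟩ : ∃ n, T.dist t w = n := ⟨_, rfl⟩
  induction n generalizing s t with
  | zero =>
    obtain rfl := hT.connected.dist_eq_zero_iff.1 hn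
    simp
  | succ n ih =>
    obtain ⟨t', u, hu⟩ := hT.exists_edgeOn t w (k := 0) (by omega)
    obtain rfl : t = t' := hT.connected.dist_eq_zero_iff.1 hu.dist_fst
    have h1 := hu.snd_dist
    have hpu : T.dist p u = T.dist p t + 1 := by
      rcases hT.dist_eq_dist_add_one_of_adj p hu.adj with h | h
      · exfalso
        have hsu : s = u := hT.eq_of_between (p := p) (q := t)
          (by rw [SimpleGraph.dist_eq_one_iff_adj.2 hst, hp])
          (by rw [SimpleGraph.dist_eq_one_iff_adj.2 hu.adj.symm, h]) (by omega)
        subst hsu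
        omega
      · exact h
    have := ih hu.adj hpu (by omega) (by omega)
    omega

theorem SimpleGraph.IsTree.even_dist_add (hT : T.IsTree) (p u v : V) :
    Even (T.dist p u + T.dist p v + T.dist u v) := by
  obtain ⟨n, hn⟩ : ∃ n, T.dist u v = n := ⟨_, rfl⟩
  induction n generalizing u with
  | zero =>
    obtain rfl := hT.connected.dist_eq_zero_iff.1 hn
    simp
  | succ n ih =>
    obtain ⟨u', w, hw⟩ := hT.exists_edgeOn u v (k := 0) (by omega)
    obtain rfl : u = u' := hT.connected.dist_eq_zero_iff.1 hw.dist_fst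
    have h1 := hw.snd_dist
    have h2 := ih w (by omega)
    rw [Nat.even_iff] at h2 ⊢
    rcases hT.dist_eq_dist_add_one_of_adj p hw.adj with h | h <;> omega

/-- The component containing `t` of the tree with the edge `(s, t)` removed. -/
def SimpleGraph.branch (T : SimpleGraph V) (s t : V) : Set V := {w | T.dist w t < T.dist w s}

theorem SimpleGraph.EdgeOn.dist_eq (hT : T.IsTree) {p q s t w : V} {k : ℕ}
    (h : T.EdgeOn p q k s t) (hw : w ∈ T.branch s t) :
    T.dist p w = k + 1 + T.dist t w ∧ T.dist s w = T.dist t w + 1 := by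
  have h1 : T.dist w t < T.dist w s := hw
  have h2 : T.dist s w = T.dist t w + 1 := by
    rw [T.dist_comm (u := s), T.dist_comm (u := t)]
    rcases hT.dist_eq_dist_add_one_of_adj w h.adj with h | h <;> omega
  have h3 := hT.dist_eq_of_separating_edge h.adj (by rw [h.dist_fst, h.dist_snd]) h2
  rw [h.dist_snd] at h3
  exact ⟨h3, h2⟩

/-- If the branches behind two edges meet, the shallower edge is on the path to the deeper one. -/
theorem SimpleGraph.EdgeOn.between_of_mem_branch (hT : T.IsTree) {p q q' s t s' t' w : V}
    {k k' : ℕ} (h : T.EdgeOn p q k s t) (h' : T.EdgeOn p q' k' s' t')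
    (hw : w ∈ T.branch s t) (hw' : w ∈ T.branch s' t') (hk : k ≤ k') :
    T.dist p t + T.dist t q' = T.dist p q' ∧ (k < k' → T.dist p t + T.dist t s' = T.dist p s') ∧
      (k = k' → s = s' ∧ t = t') := by
  obtain ⟨e1, e2⟩ := h.dist_eq hT hw
  obtain ⟨e3, e4⟩ := h'.dist_eq hT hw'
  have b1 := h.dist_fst
  have b2 := h.dist_snd
  have b3 := h'.dist_fst
  have b4 := h'.dist_snd
  have b5 := h'.fst_dist
  have b6 := h'.snd_dist
  have tri := fun u v w => hT.connected.dist_triangle (u := u) (v := v) (w := w)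
  rcases hk.eq_or_lt with rfl | hlt
  · have hs : s = s' := hT.eq_of_between (p := p) (q := w) (by omega) (by omega) (by omega)
    have ht : t = t' := hT.eq_of_between (p := p) (q := w) (by omega) (by omega) (by omega)
    subst hs ht
    exact ⟨by omega, by omega, fun _ => ⟨rfl, rfl⟩⟩
  · have hx : T.dist p t + T.dist t s' = T.dist p s' :=
      hT.between_of_dist_le (q := w) (by omega) (by omega) (by omega)
    have a1 := tri t s' q'
    have a2 := tri p t q'
    exact ⟨by omega, fun _ => hx, by omega⟩

theorem SimpleGraph.EdgeOn.dist_le_of_mem_branch (hT : T.IsTree) {p q q' s t s' t' w : V}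
    {k k' : ℕ} (h : T.EdgeOn p q k s t) (h' : T.EdgeOn p q' k' s' t')
    (hw : w ∈ T.branch s t) (hw' : w ∈ T.branch s' t') :
    T.dist q q' + 2 * (min k k' + 1) ≤ T.dist p q + T.dist p q' := by
  have tri := fun u v w => hT.connected.dist_triangle (u := u) (v := v) (w := w)
  rcases le_total k k' with hk | hk
  · have h1 := (h.between_of_mem_branch hT h' hw hw' hk).1
    have h2 := h.snd_dist
    have h3 := h.dist_snd
    have h4 := tri q t q'
    rw [T.dist_comm (u := q) (v := t)] at h4
    omega
  · have h1 := (h'.between_of_mem_branch hT h hw' hw hk).1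
    have h2 := h'.snd_dist
    have h3 := h'.dist_snd
    have h4 := tri q t' q'
    rw [T.dist_comm (u := q) (v := t')] at h4
    omega

end Tree

section PingPong

theorem MonoidHom.surjective_of_closure_pair {G H : Type*} [Group G] [Group H] {a b : G}
    (hgen : Subgroup.closure {a, b} = ⊤) (f : H →* G) (ha : a ∈ f.range) (hb : b ∈ f.range) :
    Function.Surjective f := by
  rw [← MonoidHom.range_eq_top, eq_top_iff, ← hgen, Subgroup.closure_le]
  rintro x (rfl | rfl)
  exacts [ha, hb]

instance isFreeGroup_multiplicative_int : IsFreeGroup (Multiplicative ℤ) :=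
  IsFreeGroup.ofMulEquiv (FreeGroup.mulEquivIntOfUnique (α := Unit))

theorem zpowersHom_injective_of_torsionFree {G : Type*} [Group G]
    (htf : ∀ (g : G) (n : ℕ), 1 ≤ n → g ^ n = 1 → g = 1) {a : G} (ha : a ≠ 1) :
    Function.Injective (zpowersHom G a) := by
  rw [injective_iff_map_eq_one]
  intro k hk
  rw [zpowersHom_apply] at hk
  by_contra hne
  have hk0 : k.toAdd ≠ 0 := fun h => hne (Multiplicative.toAdd.injective h)
  exact ha (htf a k.toAdd.natAbs (by omega) (pow_natAbs_eq_one.2 hk))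

theorem isFreeGroup_of_closure_singleton {G : Type*} [Group G]
    (htf : ∀ (g : G) (n : ℕ), 1 ≤ n → g ^ n = 1 → g = 1) {b : G} (hb : b ≠ 1)
    (hgen : Subgroup.closure {1, b} = ⊤) : IsFreeGroup G :=
  IsFreeGroup.ofMulEquiv (MulEquiv.ofBijective (zpowersHom G b)
    ⟨zpowersHom_injective_of_torsionFree htf hb,
      MonoidHom.surjective_of_closure_pair hgen _ (one_mem _)
        ⟨Multiplicative.ofAdd 1, by simp [zpowersHom_apply]⟩⟩)

variable {G V : Type*} [Group G] [MulAction G V]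

/-- Ping-pong for two elements playing on two pairs of sets. -/
theorem isFreeGroup_of_ping_pong.{u, v} {G : Type u} {V : Type v} [Group G]
    [MulAction G V] {a b : G} (hgen : Subgroup.closure {a, b} = ⊤)
    {X Y X' Y' : Set V} (hX : X.Nonempty) (hX' : X'.Nonempty)
    (hXY : Disjoint X Y) (hXY' : Disjoint X' Y') (h1 : Disjoint X X') (h2 : Disjoint X Y')
    (h3 : Disjoint Y X') (h4 : Disjoint Y Y')
    (ha : ∀ w, w ∉ Y → a • w ∈ X) (ha' : ∀ w, w ∉ X → a⁻¹ • w ∈ Y)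
    (hb : ∀ w, w ∉ Y' → b • w ∈ X') (hb' : ∀ w, w ∉ X' → b⁻¹ • w ∈ Y') : IsFreeGroup G := by
  let g : ULift.{u} Bool → G := fun i => cond i.down a b
  have hinj : Function.Injective (FreeGroup.lift g) := by
    refine FreeGroup.injective_lift_of_ping_pong g (fun i => cond i.down X X')
      (fun i => cond i.down Y Y')
      ?_ ?_ ?_ ?_ ?_ ?_
    · rintro ⟨_ | _⟩
      exacts [hX', hX]
    · rintro ⟨_ | _⟩ ⟨_ | _⟩ h
      exacts [(h rfl).elim, h1.symm, h1, (h rfl).elim]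
    · rintro ⟨_ | _⟩ ⟨_ | _⟩ h
      exacts [(h rfl).elim, h4.symm, h4, (h rfl).elim]
    · rintro ⟨_ | _⟩ ⟨_ | _⟩
      exacts [hXY', h3.symm, h2, hXY]
    · rintro ⟨_ | _⟩
      · rintro _ ⟨w, hw, rfl⟩
        exact hb w hw
      · rintro _ ⟨w, hw, rfl⟩
        exact ha w hw
    · rintro ⟨_ | _⟩
      · rintro _ ⟨w, hw, rfl⟩
        exact hb' w hw
      · rintro _ ⟨w, hw, rfl⟩
        exact ha' w hw
  exact IsFreeGroup.ofMulEquiv (MulEquiv.ofBijective _ ⟨hinj,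
    MonoidHom.surjective_of_closure_pair hgen _ ⟨FreeGroup.of ⟨true⟩, by simp [g]⟩
      ⟨FreeGroup.of ⟨false⟩, by simp [g]⟩⟩)

/-- Ping-pong for an element `b` playing on two sets, all of whose translates by non-trivial powers
of `a` are disjoint from them. -/
theorem isFreeGroup_of_ping_pong_translates {a b : G}
    (hgen : Subgroup.closure {a, b} = ⊤) {X Y : Set V} (hX : X.Nonempty)
    (hXY : ∀ (k : ℤ), ∀ w ∈ X, a ^ k • w ∉ Y)
    (hXX : ∀ (k : ℤ), k ≠ 0 → ∀ w ∈ X, a ^ k • w ∉ X)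
    (hYY : ∀ (k : ℤ), k ≠ 0 → ∀ w ∈ Y, a ^ k • w ∉ Y)
    (hbX : ∀ w, w ∉ Y → b • w ∈ X) (hbY : ∀ w, w ∉ X → b⁻¹ • w ∈ Y) : IsFreeGroup G := by
  have hYX : ∀ (k : ℤ), ∀ w ∈ Y, a ^ k • w ∉ X := fun k w hw hw' =>
    hXY (-k) _ hw' (by rwa [zpow_neg, inv_smul_smul])
  have hU : ∀ (k : ℤ), k ≠ 0 → ∀ w ∈ X ∪ Y, a ^ k • w ∉ X ∪ Y := by
    rintro k hk w (hw | hw) (hw' | hw')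
    exacts [hXX k hk w hw hw', hXY k w hw hw', hYX k w hw hw', hYY k hk w hw hw']
  have hXdY : ∀ w ∈ X, w ∉ Y := fun w hw => by simpa using hXY 0 w hw
  have hpos : ∀ (n : ℕ), ∀ w, w ∉ Y → b ^ (n + 1) • w ∈ X := by
    intro n
    induction n with
    | zero => simpa using hbX
    | succ n ih =>
      intro w hw
      rw [pow_succ', mul_smul]
      exact hbX _ (hXdY _ (ih w hw))
  have hneg : ∀ (n : ℕ), ∀ w, w ∉ X → b⁻¹ ^ (n + 1) • w ∈ Y := by
    intro n
    induction n with
    | zero => simpa using hbY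
    | succ n ih =>
      intro w hw
      rw [pow_succ', mul_smul]
      exact hbY _ fun h => hXdY _ h (ih w hw)
  have hbU : ∀ (k : ℤ), k ≠ 0 → ∀ w, w ∉ X ∪ Y → b ^ k • w ∈ X ∪ Y := by
    intro k hk w hw
    rcases k with n | n
    · obtain ⟨m, rfl⟩ := Nat.exists_eq_succ_of_ne_zero (n := n) (by rintro rfl; exact hk rfl)
      change b ^ ((m + 1 : ℕ) : ℤ) • w ∈ X ∪ Y
      rw [zpow_natCast]
      exact Or.inl (hpos m w fun h => hw (Or.inr h))
    · right
      rw [zpow_negSucc, ← inv_pow]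
      exact hneg n w fun h => hw (Or.inl h)
  let g : Bool → G := fun i => cond i a b
  let f : ∀ _ : Bool, Multiplicative ℤ →* G := fun i => zpowersHom G (g i)
  have hinj : Function.Injective (Monoid.CoprodI.lift f) := by
    refine Monoid.CoprodI.lift_injective_of_ping_pong f
      (Or.inr ⟨true, ?_⟩)
      (fun i => cond i {w | ∃ k : ℤ, k ≠ 0 ∧ ∃ u ∈ X ∪ Y, a ^ k • u = w} (X ∪ Y)) ?_ ?_ ?_
    · exact (Cardinal.natCast_lt_aleph0 (n := 3)).le.trans (Cardinal.aleph0_le_mk _)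
    · rintro (_ | _)
      · exact hX.inl
      · obtain ⟨u, hu⟩ := hX
        exact ⟨a ^ (1 : ℤ) • u, 1, one_ne_zero, u, Or.inl hu, rfl⟩
    · have hd : Disjoint {w | ∃ k : ℤ, k ≠ 0 ∧ ∃ u ∈ X ∪ Y, a ^ k • u = w} (X ∪ Y) := by
        rw [Set.disjoint_left]
        rintro _ ⟨k, hk, u, hu, rfl⟩
        exact hU k hk u hu
      rintro (_ | _) (_ | _) h
      exacts [(h rfl).elim, hd.symm, hd, (h rfl).elim]
    · rintro (_ | _) (_ | _) h k hk
      · exact (h rfl).elim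
      · rintro _ ⟨_, ⟨l, hl, u, hu, rfl⟩, rfl⟩
        exact hbU k.toAdd (fun h => hk (Multiplicative.toAdd.injective h)) _ (hU l hl u hu)
      · rintro _ ⟨u, hu, rfl⟩
        exact ⟨k.toAdd, fun h => hk (Multiplicative.toAdd.injective h), u, hu, rfl⟩
      · exact (h rfl).elim
  exact IsFreeGroup.ofMulEquiv (MulEquiv.ofBijective _ ⟨hinj,
    MonoidHom.surjective_of_closure_pair hgen _
      ⟨Monoid.CoprodI.of (i := true) (Multiplicative.ofAdd 1), by simp [f, g, zpowersHom_apply]⟩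
      ⟨Monoid.CoprodI.of (i := false) (Multiplicative.ofAdd 1),
        by simp [f, g, zpowersHom_apply]⟩⟩)

end PingPong

section Action

variable {G V : Type*} [Group G] {T : SimpleGraph V} [MulAction G V]

theorem SimpleGraph.dist_smul_of_adj (hT : T.IsTree)
    (hsimp : ∀ (g : G) (u v : V), T.Adj u v → T.Adj (g • u) (g • v)) (g : G) (u v : V) :
    T.dist (g • u) (g • v) = T.dist u v := by
  have key : ∀ (g : G) (u v : V), T.dist (g • u) (g • v) ≤ T.dist u v := by
    intro g u v
    obtain ⟨W, hW⟩ := hT.connected.exists_walk_length_eq_dist u v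
    let φ : T →g T := ⟨fun x => g • x, fun {x y} h => hsimp g x y h⟩
    have := SimpleGraph.dist_le (W.map φ)
    rw [SimpleGraph.Walk.length_map, hW] at this
    exact this
  refine (key g u v).antisymm ?_
  simpa using key g⁻¹ (g • u) (g • v)

theorem SimpleGraph.EdgeOn.smul (hT : T.IsTree)
    (hsimp : ∀ (g : G) (u v : V), T.Adj u v → T.Adj (g • u) (g • v)) {p q s t : V} {k : ℕ}
    (h : T.EdgeOn p q k s t) (g : G) : T.EdgeOn (g • p) (g • q) k (g • s) (g • t) := by
  have hd := SimpleGraph.dist_smul_of_adj hT hsimp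
  constructor
  · exact hsimp g _ _ h.adj
  · rw [hd, h.dist_fst]
  · rw [hd, h.dist_snd]
  · rw [hd, hd, h.fst_dist]
  · rw [hd, hd, h.snd_dist]

theorem SimpleGraph.EdgeOn.symm {p q s t : V} {k k' : ℕ} (h : T.EdgeOn p q k s t)
    (hk : k + k' + 1 = T.dist p q) : T.EdgeOn q p k' t s := by
  obtain ⟨h0, h1, h2, h3, h4⟩ := h
  constructor
  · exact h0.symm
  · rw [T.dist_comm]; omega
  · rw [T.dist_comm]; omega
  · rw [T.dist_comm, T.dist_comm (u := q)]; omega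
  · rw [T.dist_comm, T.dist_comm (u := q)]; omega

theorem SimpleGraph.EdgeOn.inv_smul (hT : T.IsTree)
    (hsimp : ∀ (g : G) (u v : V), T.Adj u v → T.Adj (g • u) (g • v)) {v s t : V} {k k' : ℕ} {g : G}
    (h : T.EdgeOn v (g • v) k s t) (hk : k + k' + 1 = T.dist v (g • v)) :
    T.EdgeOn v (g⁻¹ • v) k' (g⁻¹ • t) (g⁻¹ • s) := by
  simpa using (h.symm hk).smul hT hsimp g⁻¹

theorem SimpleGraph.snd_mem_branch {s t : V} (h : T.Adj s t) : t ∈ T.branch s t := by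
  change T.dist t t < T.dist t s
  rw [SimpleGraph.dist_self, SimpleGraph.dist_eq_one_iff_adj.2 h.symm]
  exact one_pos

theorem SimpleGraph.smul_mem_branch_smul (hT : T.IsTree)
    (hsimp : ∀ (g : G) (u v : V), T.Adj u v → T.Adj (g • u) (g • v)) {s t w : V} (g : G)
    (hw : w ∈ T.branch s t) : g • w ∈ T.branch (g • s) (g • t) := by
  have hd := SimpleGraph.dist_smul_of_adj hT hsimp
  change T.dist _ _ < T.dist _ _
  rw [hd, hd]
  exact hw

theorem SimpleGraph.IsTree.mem_branch_of_notMem (hT : T.IsTree) {s t w : V} (h : T.Adj s t)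
    (hw : w ∉ T.branch s t) : w ∈ T.branch t s := by
  have h1 : ¬ T.dist w t < T.dist w s := hw
  have h2 := hT.dist_ne_of_adj w h
  change T.dist w s < T.dist w t
  omega

theorem SimpleGraph.smul_mem_branch_of_notMem (hT : T.IsTree)
    (hsimp : ∀ (g : G) (u v : V), T.Adj u v → T.Adj (g • u) (g • v)) {s t w : V} (g : G)
    (h : T.Adj s t) (hw : w ∉ T.branch (g⁻¹ • t) (g⁻¹ • s)) : g • w ∈ T.branch s t := by
  simpa using SimpleGraph.smul_mem_branch_smul hT hsimp g
    (hT.mem_branch_of_notMem (hsimp g⁻¹ _ _ h.symm) hw)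

theorem SimpleGraph.inv_smul_mem_branch_of_notMem (hT : T.IsTree)
    (hsimp : ∀ (g : G) (u v : V), T.Adj u v → T.Adj (g • u) (g • v)) {s t w : V} (g : G)
    (h : T.Adj s t) (hw : w ∉ T.branch s t) : g⁻¹ • w ∈ T.branch (g⁻¹ • t) (g⁻¹ • s) :=
  SimpleGraph.smul_mem_branch_smul hT hsimp g⁻¹ (hT.mem_branch_of_notMem h hw)

/-- In a tree, the parity of the displacement of a vertex does not depend on the vertex. -/
theorem SimpleGraph.even_dist_smul_iff (hT : T.IsTree)
    (hsimp : ∀ (g : G) (u v : V), T.Adj u v → T.Adj (g • u) (g • v)) (g : G) (u v : V) :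
    Even (T.dist u (g • u)) ↔ Even (T.dist v (g • v)) := by
  have hd := SimpleGraph.dist_smul_of_adj hT hsimp g u v
  have h1 := hT.even_dist_add v u (g • u)
  have h2 := hT.even_dist_add (g • u) v (g • v)
  rw [T.dist_comm (u := g • u) (v := v)] at h2
  rw [T.dist_comm (u := v) (v := u)] at h1
  rw [Nat.even_iff] at *
  rw [Nat.even_iff]
  omega

/-- A generating pair of a group acting on a tree with all vertices in one orbit contains an element
displacing every vertex by an odd distance. -/
theorem SimpleGraph.odd_dist_smul_of_generating (hT : T.IsTree)
    (hsimp : ∀ (g : G) (u v : V), T.Adj u v → T.Adj (g • u) (g • v))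
    (hedge : ∃ u w : V, T.Adj u w) (hvtrans : ∀ u v : V, ∃ g : G, g • u = v) {a b : G}
    (hgen : Subgroup.closure {a, b} = ⊤) {u : V} (ha : Even (T.dist u (a • u))) (v : V) :
    Odd (T.dist v (b • v)) := by
  have hpar := SimpleGraph.even_dist_smul_iff hT hsimp
  by_contra hb
  rw [Nat.not_odd_iff_even] at hb
  let K : Subgroup G :=
    { carrier := {g | ∀ v : V, Even (T.dist v (g • v))}
      one_mem' := by simp
      mul_mem' := by
        intro g h hg hh v
        have h1 := hT.even_dist_add (h • v) v (g • h • v)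
        have h2 := hg (h • v)
        have h3 := hh v
        rw [T.dist_comm (u := h • v) (v := v)] at h1
        rw [mul_smul]
        rw [Nat.even_iff] at *
        omega
      inv_mem' := by
        intro g hg v
        have := hg (g⁻¹ • v)
        rwa [smul_inv_smul, T.dist_comm] at this }
  have hK : K = ⊤ := by
    rw [eq_top_iff, ← hgen, Subgroup.closure_le]
    rintro x (rfl | rfl)
    · exact fun v => (hpar _ _ _).1 ha
    · exact fun w => (hpar _ _ _).1 hb
  obtain ⟨x, y, hxy⟩ := hedge
  obtain ⟨g, rfl⟩ := hvtrans x y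
  have hg : g ∈ K := hK ▸ Subgroup.mem_top g
  have := hg x
  rw [SimpleGraph.dist_eq_one_iff_adj.2 hxy] at this
  exact absurd this (by decide)

theorem Subgroup.closure_pair_eq_top_of_mem {a b c d : G} (hgen : Subgroup.closure {a, b} = ⊤)
    (ha : a ∈ Subgroup.closure {c, d}) (hb : b ∈ Subgroup.closure {c, d}) :
    Subgroup.closure {c, d} = ⊤ := by
  rw [eq_top_iff, ← hgen, Subgroup.closure_le]
  rintro x (rfl | rfl)
  exacts [ha, hb]

end Action

section Elliptic

variable {G V : Type*} [Group G] {T : SimpleGraph V} [MulAction G V]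

theorem zpow_smul_eq_of_smul_eq {g : G} {x : V} (h : g • x = x) (k : ℤ) : g ^ k • x = x :=
  (MulAction.stabilizer G x).zpow_mem h k

theorem pow_smul_eq_of_smul_eq {g : G} {x : V} (h : g • x = x) (n : ℕ) : g ^ n • x = x :=
  (MulAction.stabilizer G x).pow_mem h n

theorem pow_natAbs_smul_eq_of_zpow_smul_eq {a : G} {k : ℤ} {x : V} (h : a ^ k • x = x) :
    a ^ k.natAbs • x = x := by
  rcases Int.natAbs_eq k with hk | hk
  · rw [hk, zpow_natCast] at h
    exact h
  · rw [hk, zpow_neg, zpow_natCast, inv_smul_eq_iff] at h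
    exact h.symm

/-- An elliptic element of a torsion-free group acting 2-acylindrically on a tree has a fixed vertex
within distance one of every vertex fixed by one of its powers. -/
theorem exists_center_of_smul_eq (hT : T.IsTree)
    (hsimp : ∀ (g : G) (u v : V), T.Adj u v → T.Adj (g • u) (g • v))
    (hacyl : ∀ g : G, g ≠ 1 → ∀ u v : V, g • u = u → g • v = v → T.dist u v ≤ 2)
    (htf : ∀ (g : G) (n : ℕ), 1 ≤ n → g ^ n = 1 → g = 1) {a : G} (ha : a ≠ 1) {c₀ : V}
    (hc₀ : a • c₀ = c₀) :
    ∃ c : V, a • c = c ∧ ∀ (n : ℕ) (y : V), 1 ≤ n → a ^ n • y = y → T.dist c y ≤ 1 := by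
  have hd := SimpleGraph.dist_smul_of_adj hT hsimp
  have tri := fun u v w => hT.connected.dist_triangle (u := u) (v := v) (w := w)
  have hpow : ∀ n : ℕ, 1 ≤ n → a ^ n ≠ 1 := fun n hn h => ha (htf a n hn h)
  have hfix : ∀ n : ℕ, a ^ n • c₀ = c₀ := pow_smul_eq_of_smul_eq hc₀
  by_cases hall : ∀ (n : ℕ) (y : V), 1 ≤ n → a ^ n • y = y → T.dist c₀ y ≤ 1
  · exact ⟨c₀, hc₀, hall⟩
  push Not at hall
  obtain ⟨n, y, hn, hy, hlt⟩ := hall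
  have hle := hacyl _ (hpow n hn) _ _ (hfix n) hy
  obtain ⟨c, s, hs⟩ := hT.exists_edgeOn c₀ y (k := 0) (by omega)
  obtain rfl : c₀ = c := hT.connected.dist_eq_zero_iff.1 hs.dist_fst
  have hs1 := hs.dist_snd
  have hs2 := hs.snd_dist
  have hsep : ∀ z, T.dist z y ≤ 2 → T.dist c₀ z ≤ 2 → T.dist s z ≤ 1 := by
    intro z hz1 hz2
    by_contra hz3
    rw [T.dist_comm] at hz2 hz3
    have hz4 : T.dist z s = T.dist z c₀ + 1 := by
      rcases hT.dist_eq_dist_add_one_of_adj z hs.adj with h | h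
      · have h5 := hT.even_dist_add z c₀ y
        rw [Nat.even_iff] at h5
        have h6 := hT.even_dist_add z s y
        rw [Nat.even_iff] at h6
        have h7 := tri z s y
        omega
      · exact h
    have := hT.dist_eq_of_separating_edge (p := z) (w := y) hs.adj hz4 (by omega)
    omega
  refine ⟨s, ?_, fun m z hm hz => ?_⟩
  · have hay : a ^ n • a • y = a • y := by
      rw [← mul_smul, ← pow_succ, pow_succ', mul_smul, hy]
    have h1 : T.dist c₀ (a • y) = T.dist c₀ y := by
      conv_lhs => rw [← hc₀, hd]
    have h2 := hsep (a • y) (hacyl _ (hpow n hn) _ _ hay hy) (by omega)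
    have h3 : T.dist c₀ (a • s) = T.dist c₀ s := by
      conv_lhs => rw [← hc₀, hd]
    have h4 := tri c₀ s (a • y)
    exact hT.eq_of_between (p := c₀) (q := a • y) (by rw [hd, h3, h1]; omega)
      (by omega) h3
  · have hN : 1 ≤ n * m := Nat.mul_pos hn hm
    have hz' : a ^ (n * m) • z = z := by
      rw [mul_comm, pow_mul]
      exact pow_smul_eq_of_smul_eq hz n
    have hy' : a ^ (n * m) • y = y := by
      rw [pow_mul]
      exact pow_smul_eq_of_smul_eq hy m
    exact hsep z (hacyl _ (hpow _ hN) _ _ hz' hy') (hacyl _ (hpow _ hN) _ _ (hfix _) hz')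

/-- If one element of a generating pair is elliptic and the other one displaces vertices by odd
distances, then either the group is free, or the two elements are linked along an edge. -/
theorem isFreeGroup_or_linked_of_elliptic (hT : T.IsTree)
    (hsimp : ∀ (g : G) (u v : V), T.Adj u v → T.Adj (g • u) (g • v))
    (hninv : ∀ (g : G) (u v : V), T.Adj u v → ¬(g • u = v ∧ g • v = u))
    (hacyl : ∀ g : G, g ≠ 1 → ∀ u v : V, g • u = u → g • v = v → T.dist u v ≤ 2)
    (htf : ∀ (g : G) (n : ℕ), 1 ≤ n → g ^ n = 1 → g = 1) {a b : G}
    (hgen : Subgroup.closure {a, b} = ⊤) (ha : a ≠ 1) {c₀ : V} (hc₀ : a • c₀ = c₀)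
    (hb : ∀ v : V, Odd (T.dist v (b • v))) :
    IsFreeGroup G ∨ ∃ (x y : V) (n : ℕ), T.Adj x y ∧ 1 ≤ n ∧ a • x = x ∧ a ^ n • y = y ∧
      (b • x = y ∨ b • y = x) := by
  obtain ⟨c, hc, hstar⟩ := exists_center_of_smul_eq hT hsimp hacyl htf ha hc₀
  have hstar' : ∀ (k : ℤ) (y : V), k ≠ 0 → a ^ k • y = y → T.dist c y ≤ 1 :=
    fun k y hk hy => hstar k.natAbs y (by omega) (pow_natAbs_smul_eq_of_zpow_smul_eq hy)
  obtain ⟨i, hi⟩ := hb c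
  obtain ⟨s, t, hst⟩ := hT.exists_edgeOn c (b • c) (k := i) (by omega)
  have hst' := hst.inv_smul hT hsimp (k' := i) (by omega)
  have hpc : ∀ k : ℤ, a ^ k • c = c := zpow_smul_eq_of_smul_eq hc
  have htrans : ∀ (k : ℤ) {q x y : V}, T.EdgeOn c q i x y →
      T.EdgeOn c (a ^ k • q) i (a ^ k • x) (a ^ k • y) := by
    intro k q x y h
    have := h.smul hT hsimp (a ^ k)
    rwa [hpc] at this
  refine or_iff_not_imp_right.2 fun hno => ?_
  refine isFreeGroup_of_ping_pong_translates (X := T.branch s t)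
    (Y := T.branch (b⁻¹ • t) (b⁻¹ • s)) hgen ⟨t, SimpleGraph.snd_mem_branch hst.adj⟩ ?_ ?_ ?_
    (fun w => SimpleGraph.smul_mem_branch_of_notMem hT hsimp b hst.adj)
    (fun w => SimpleGraph.inv_smul_mem_branch_of_notMem hT hsimp b hst.adj)
  · intro k w hw hw'
    obtain ⟨h1, h2⟩ := ((htrans k hst).between_of_mem_branch hT hst'
      (SimpleGraph.smul_mem_branch_smul hT hsimp _ hw) hw' le_rfl).2.2 rfl
    refine hninv (b * a ^ k) s t hst.adj ⟨?_, ?_⟩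
    · rw [mul_smul, h1, smul_inv_smul]
    · rw [mul_smul, h2, smul_inv_smul]
  · intro k hk w hw hw'
    obtain ⟨h1, h2⟩ := ((htrans k hst).between_of_mem_branch hT hst
      (SimpleGraph.smul_mem_branch_smul hT hsimp _ hw) hw' le_rfl).2.2 rfl
    have hi0 := hstar' k t hk h2
    rw [hst.dist_snd] at hi0
    obtain rfl : c = s := hT.connected.dist_eq_zero_iff.1 (by rw [hst.dist_fst]; omega)
    obtain rfl : t = b • c := hT.connected.dist_eq_zero_iff.1 (by have := hst.snd_dist; omega)
    exact hno ⟨c, b • c, k.natAbs, hst.adj, by omega, hc, pow_natAbs_smul_eq_of_zpow_smul_eq h2,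
      Or.inl rfl⟩
  · intro k hk w hw hw'
    obtain ⟨h1, h2⟩ := ((htrans k hst').between_of_mem_branch hT hst'
      (SimpleGraph.smul_mem_branch_smul hT hsimp _ hw) hw' le_rfl).2.2 rfl
    have hi0 := hstar' k _ hk h2
    rw [hst'.dist_snd] at hi0
    have hs : c = s := hT.connected.dist_eq_zero_iff.1 (by rw [hst.dist_fst]; omega)
    have ht : c = b⁻¹ • t := hT.connected.dist_eq_zero_iff.1 (by rw [hst'.dist_fst]; omega)
    have hadj := hst'.adj
    rw [← ht] at hadj
    exact hno ⟨c, b⁻¹ • s, k.natAbs, hadj, by omega, hc, pow_natAbs_smul_eq_of_zpow_smul_eq h2,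
      Or.inr (by rw [smul_inv_smul, hs])⟩

end Elliptic

section Minimal

variable {G V : Type*} [Group G] {T : SimpleGraph V} [MulAction G V]

theorem SimpleGraph.dist_inv_smul (hT : T.IsTree)
    (hsimp : ∀ (g : G) (u v : V), T.Adj u v → T.Adj (g • u) (g • v)) (g : G) (v : V) :
    T.dist v (g⁻¹ • v) = T.dist v (g • v) := by
  have := SimpleGraph.dist_smul_of_adj hT hsimp g v (g⁻¹ • v)
  rw [smul_inv_smul] at this
  rw [← this, T.dist_comm]

/-- Nielsen reduced pairs generate free groups, provided the overlaps of the geodesic to `a⁻¹ • v`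
with those to `b • v` and `b⁻¹ • v` do not reach the chosen edge. -/
theorem isFreeGroup_of_nielsen_reduced (hT : T.IsTree)
    (hsimp : ∀ (g : G) (u v : V), T.Adj u v → T.Adj (g • u) (g • v))
    (hninv : ∀ (g : G) (u v : V), T.Adj u v → ¬(g • u = v ∧ g • v = u)) {a b : G}
    (hgen : Subgroup.closure {a, b} = ⊤) {v s t : V} {k k' l : ℕ}
    (ha : T.EdgeOn v (a • v) k s t) (hk : k + k' + 1 = T.dist v (a • v)) (hkk : k' ≤ k)
    (hkk' : k ≤ k' + 1) (hb : T.dist v (b • v) = 2 * l + 1)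
    (hmin : ∀ g h, (g = a ∨ g = a⁻¹) → (h = b ∨ h = b⁻¹) →
      T.dist v (a • v) ≤ T.dist (g • v) (h • v) ∧ T.dist v (b • v) ≤ T.dist (g • v) (h • v))
    (haa : Disjoint (T.branch s t) (T.branch (a⁻¹ • t) (a⁻¹ • s)))
    (hY : k = k' + 1 → ∀ h, (h = b ∨ h = b⁻¹) →
      T.dist v (a⁻¹ • s) + T.dist (a⁻¹ • s) (h • v) ≠ T.dist v (h • v)) : IsFreeGroup G := by
  obtain ⟨x, y, hxy⟩ := hT.exists_edgeOn v (b • v) (k := l) (by omega)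
  have ha' := ha.inv_smul hT hsimp hk
  have hxy' := hxy.inv_smul hT hsimp (k' := l) (by omega)
  have hia := SimpleGraph.dist_inv_smul hT hsimp a v
  have hib := SimpleGraph.dist_inv_smul hT hsimp b v
  have hbb : Disjoint (T.branch x y) (T.branch (b⁻¹ • y) (b⁻¹ • x)) := by
    rw [Set.disjoint_left]
    intro w hw hw'
    obtain ⟨h1, h2⟩ := (hxy.between_of_mem_branch hT hxy' hw hw' le_rfl).2.2 rfl
    refine hninv b x y hxy.adj ⟨?_, ?_⟩
    · rw [h1, smul_inv_smul]
    · rw [h2, smul_inv_smul]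
  have hX : ∀ h x' y', (h = b ∨ h = b⁻¹) → T.EdgeOn v (h • v) l x' y' →
      Disjoint (T.branch s t) (T.branch x' y') := by
    intro h x' y' hh he
    rw [Set.disjoint_left]
    intro w hw hw'
    have h1 := ha.dist_le_of_mem_branch hT he hw hw'
    have h2 := hmin a h (Or.inl rfl) hh
    have h3 : T.dist v (h • v) = T.dist v (b • v) := by
      rcases hh with rfl | rfl
      exacts [rfl, hib]
    omega
  have hY' : ∀ h x' y', (h = b ∨ h = b⁻¹) → T.EdgeOn v (h • v) l x' y' →
      Disjoint (T.branch (a⁻¹ • t) (a⁻¹ • s)) (T.branch x' y') := by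
    intro h x' y' hh he
    rw [Set.disjoint_left]
    intro w hw hw'
    have h1 := ha'.dist_le_of_mem_branch hT he hw hw'
    have h2 := hmin a⁻¹ h (Or.inr rfl) hh
    have h3 : T.dist v (h • v) = T.dist v (b • v) := by
      rcases hh with rfl | rfl
      exacts [rfl, hib]
    have h4 : k = k' + 1 := by omega
    exact hY h4 h hh (ha'.between_of_mem_branch hT he hw hw' (by omega)).1
  exact isFreeGroup_of_ping_pong hgen ⟨t, SimpleGraph.snd_mem_branch ha.adj⟩
    ⟨y, SimpleGraph.snd_mem_branch hxy.adj⟩ haa hbb (hX b _ _ (Or.inl rfl) hxy)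
    (hX b⁻¹ _ _ (Or.inr rfl) hxy') (hY' b _ _ (Or.inl rfl) hxy) (hY' b⁻¹ _ _ (Or.inr rfl) hxy')
    (fun w => SimpleGraph.smul_mem_branch_of_notMem hT hsimp a ha.adj)
    (fun w => SimpleGraph.inv_smul_mem_branch_of_notMem hT hsimp a ha.adj)
    (fun w => SimpleGraph.smul_mem_branch_of_notMem hT hsimp b hxy.adj)
    (fun w => SimpleGraph.inv_smul_mem_branch_of_notMem hT hsimp b hxy.adj)

theorem isFreeGroup_of_nielsen_reduced_of_even (hT : T.IsTree)
    (hsimp : ∀ (g : G) (u v : V), T.Adj u v → T.Adj (g • u) (g • v))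
    (hninv : ∀ (g : G) (u v : V), T.Adj u v → ¬(g • u = v ∧ g • v = u)) {a b : G}
    (hgen : Subgroup.closure {a, b} = ⊤) {v m : V} {i l : ℕ} (hfix : ∀ x : V, a • x ≠ x)
    (hvm : T.dist v m = i) (hma : T.dist m (a • v) = i) (ha : T.dist v (a • v) = 2 * i)
    (hb : T.dist v (b • v) = 2 * l + 1)
    (hmin : ∀ g h, (g = a ∨ g = a⁻¹) → (h = b ∨ h = b⁻¹) →
      T.dist v (a • v) ≤ T.dist (g • v) (h • v) ∧ T.dist v (b • v) ≤ T.dist (g • v) (h • v))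
    (hY : ∀ h, (h = b ∨ h = b⁻¹) →
      T.dist v (a⁻¹ • m) + T.dist (a⁻¹ • m) (h • v) ≠ T.dist v (h • v)) : IsFreeGroup G := by
  have hi : i ≠ 0 := by
    rintro rfl
    exact hfix v (hT.connected.dist_eq_zero_iff.1 ha).symm
  obtain ⟨s, t, hst⟩ := hT.exists_edgeOn v (a • v) (k := i) (by omega)
  obtain rfl : s = m := hT.eq_of_between (p := v) (q := a • v)
    (by have := hst.fst_dist; have := hst.dist_fst; omega) (by omega)
    (by rw [hst.dist_fst, hvm])
  have hst' := hst.inv_smul hT hsimp (k' := i - 1) (by omega)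
  refine isFreeGroup_of_nielsen_reduced hT hsimp hninv hgen hst (k' := i - 1) (by omega) (by omega)
    (by omega) hb hmin ?_ fun _ => hY
  rw [Set.disjoint_left]
  intro w hw hw'
  have h1 := (hst'.between_of_mem_branch hT hst hw' hw (by omega)).2.1 (by omega)
  have h2 := hst'.dist_snd
  have h3 : a⁻¹ • s = s := hT.connected.dist_eq_zero_iff.1 (by omega)
  exact hfix s (inv_smul_eq_iff.1 h3).symm

/-- A pair of hyperbolic generators, one of odd displacement, minimizing the sum of the
displacements of a vertex generates a free group. -/
theorem isFreeGroup_of_minimal (hT : T.IsTree)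
    (hsimp : ∀ (g : G) (u v : V), T.Adj u v → T.Adj (g • u) (g • v))
    (hninv : ∀ (g : G) (u v : V), T.Adj u v → ¬(g • u = v ∧ g • v = u)) {a b : G}
    (hgen : Subgroup.closure {a, b} = ⊤) {v : V} (hfix : ∀ x : V, a • x ≠ x)
    (hb : Odd (T.dist v (b • v)))
    (hglob : ∀ (g h : G) (u : V), Subgroup.closure {g, h} = ⊤ →
      T.dist v (a • v) + T.dist v (b • v) ≤ T.dist u (g • u) + T.dist u (h • u)) :
    IsFreeGroup G := by
  have hd := SimpleGraph.dist_smul_of_adj hT hsimp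
  have tri := fun u v w => hT.connected.dist_triangle (u := u) (v := v) (w := w)
  have hinv := SimpleGraph.dist_inv_smul hT hsimp
  have hmem : ∀ g h : G, g ∈ Subgroup.closure {g, h} ∧ h ∈ Subgroup.closure {g, h} :=
    fun g h => ⟨Subgroup.subset_closure (Or.inl rfl), Subgroup.subset_closure (Or.inr rfl)⟩
  have hgen' : ∀ g h, (g = a ∨ g = a⁻¹) → (h = b ∨ h = b⁻¹) →
      Subgroup.closure {g, h} = ⊤ := by
    intro g h hg hh
    refine Subgroup.closure_pair_eq_top_of_mem hgen ?_ ?_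
    · rcases hg with rfl | rfl
      · exact (hmem _ _).1
      · exact inv_mem_iff.1 (hmem _ _).1
    · rcases hh with rfl | rfl
      · exact (hmem _ _).2
      · exact inv_mem_iff.1 (hmem _ _).2
  have hlen : ∀ g h, (g = a ∨ g = a⁻¹) → (h = b ∨ h = b⁻¹) →
      T.dist v (g • v) = T.dist v (a • v) ∧ T.dist v (h • v) = T.dist v (b • v) := by
    rintro g h (rfl | rfl) (rfl | rfl) <;> simp [hinv]
  have hmin : ∀ g h, (g = a ∨ g = a⁻¹) → (h = b ∨ h = b⁻¹) →
      T.dist v (a • v) ≤ T.dist (g • v) (h • v) ∧ T.dist v (b • v) ≤ T.dist (g • v) (h • v) := by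
    intro g h hg hh
    have h1 : T.dist (g • v) (h • v) = T.dist v ((g⁻¹ * h) • v) := by
      rw [← hd g⁻¹, inv_smul_smul, mul_smul]
    obtain ⟨h2, h3⟩ := hlen g h hg hh
    have h4 := hglob g (g⁻¹ * h) v (Subgroup.closure_pair_eq_top_of_mem (hgen' g h hg hh)
      (hmem _ _).1 (by simpa using mul_mem (hmem g (g⁻¹ * h)).1 (hmem g (g⁻¹ * h)).2))
    have h5 := hglob (g⁻¹ * h) h v (Subgroup.closure_pair_eq_top_of_mem (hgen' g h hg hh)
      (by simpa using mul_mem (hmem (g⁻¹ * h) h).2 (inv_mem (hmem (g⁻¹ * h) h).1)) (hmem _ _).2)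
    omega
  obtain ⟨l, hl⟩ := hb
  rcases Nat.even_or_odd' (T.dist v (a • v)) with ⟨i, hi | hi⟩
  · obtain ⟨m, hm1, hm2⟩ := hT.exists_between v (a • v) (k := i) (by omega)
    have hi0 : i ≠ 0 := by
      rintro rfl
      exact hfix v (hT.connected.dist_eq_zero_iff.1 hi).symm
    have hm3 : T.dist v (a⁻¹ • m) = i := by
      rw [← hd a, smul_inv_smul, T.dist_comm]
      omega
    have hm4 : T.dist (a⁻¹ • m) (a⁻¹ • v) = i := by rw [hd, T.dist_comm, hm1]
    by_cases hY : ∀ h, (h = b ∨ h = b⁻¹) →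
        T.dist v (a⁻¹ • m) + T.dist (a⁻¹ • m) (h • v) ≠ T.dist v (h • v)
    · exact isFreeGroup_of_nielsen_reduced_of_even hT hsimp hninv hgen hfix hm1 (by omega) hi hl
        hmin hY
    · push Not at hY
      obtain ⟨h', hh', hY'⟩ := hY
      refine isFreeGroup_of_nielsen_reduced_of_even hT hsimp hninv
        (hgen' a⁻¹ b (.inr rfl) (.inl rfl))
        (fun x hx => hfix x (inv_smul_eq_iff.1 hx).symm) hm3 hm4 (by rw [hinv, hi]) hl ?_ ?_
      · intro g h hg hh
        rw [hinv]
        refine hmin g h ?_ hh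
        rwa [inv_inv, or_comm] at hg
      intro h hh hY
      rw [inv_inv, smul_inv_smul] at hY
      by_cases hhh : h = h'
      · subst hhh
        have := hT.eq_of_between hY hY' (by omega)
        exact hfix m (by conv_lhs => rw [this, smul_inv_smul])
      have hinvh : h' = h⁻¹ := by
        rcases hh with rfl | rfl <;> rcases hh' with rfl | rfl <;> simp_all
      subst hinvh
      have hlb : T.dist v (h • v) = T.dist v (b • v) := (hlen a h (.inl rfl) hh).2
      rw [hinv, hm3] at hY'
      set n := h • a⁻¹ • m with hn
      have hn1 : T.dist n (h • v) = i := by rw [hn, hd, T.dist_comm, hm3]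
      have hn2 : T.dist v n = T.dist (a⁻¹ • m) (h⁻¹ • v) := by
        rw [← hd h (a⁻¹ • m), smul_inv_smul, T.dist_comm]
      have hmn : T.dist m n + T.dist v (b • v) = 2 * i ∨
          T.dist m n + 2 * i = T.dist v (b • v) := by
        rcases le_total (T.dist v m) (T.dist v n) with hle | hle
        · have := hT.between_of_dist_le hY (by omega) hle
          omega
        · have := hT.between_of_dist_le (by omega) hY hle
          rw [T.dist_comm (u := n)] at this
          omega
      have hnm : T.dist m ((h * a⁻¹) • m) = T.dist m n := by rw [mul_smul]
      have h1 := hglob a (h * a⁻¹) m (Subgroup.closure_pair_eq_top_of_mem (hgen' a h (.inl rfl) hh)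
        (hmem _ _).1 (by simpa using mul_mem (hmem a (h * a⁻¹)).2 (hmem a (h * a⁻¹)).1))
      have h2 := hglob (h * a⁻¹) h m (Subgroup.closure_pair_eq_top_of_mem (hgen' a h (.inl rfl) hh)
        (by simpa using mul_mem (inv_mem (hmem (h * a⁻¹) h).1) (hmem (h * a⁻¹) h).2) (hmem _ _).2)
      have h3 := tri m (a • v) (a • m)
      have h4 := tri m (h • v) (h • m)
      rw [hd] at h3 h4
      omega
  · obtain ⟨s, t, hst⟩ := hT.exists_edgeOn v (a • v) (k := i) (by omega)
    have hst' := hst.inv_smul hT hsimp (k' := i) (by omega)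
    refine isFreeGroup_of_nielsen_reduced hT hsimp hninv hgen hst (k' := i) (by omega) le_rfl
      (by omega) hl hmin ?_ (by omega)
    rw [Set.disjoint_left]
    intro w hw hw'
    obtain ⟨h1, h2⟩ := (hst.between_of_mem_branch hT hst' hw hw' le_rfl).2.2 rfl
    refine hninv a s t hst.adj ⟨?_, ?_⟩
    · rw [h1, smul_inv_smul]
    · rw [h2, smul_inv_smul]

/-- A two-generated group acting without inversions on a tree with all vertices in one orbit is
free, or has a generating pair containing an elliptic element. -/
theorem isFreeGroup_or_exists_elliptic_generator (hT : T.IsTree)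
    (hsimp : ∀ (g : G) (u v : V), T.Adj u v → T.Adj (g • u) (g • v))
    (hninv : ∀ (g : G) (u v : V), T.Adj u v → ¬(g • u = v ∧ g • v = u))
    (hedge : ∃ u w : V, T.Adj u w) (hvtrans : ∀ u v : V, ∃ g : G, g • u = v)
    (h2gen : ∃ a b : G, Subgroup.closure {a, b} = ⊤) :
    IsFreeGroup G ∨ ∃ (a b : G) (c : V), Subgroup.closure {a, b} = ⊤ ∧ a • c = c := by
  classical
  refine or_iff_not_imp_right.2 fun hno => ?_
  push Not at hno
  obtain ⟨p, _, _⟩ := id hedge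
  have hex : ∃ n : ℕ, ∃ (a b : G) (v : V), Subgroup.closure {a, b} = ⊤ ∧
      T.dist v (a • v) + T.dist v (b • v) = n := by
    obtain ⟨a, b, hab⟩ := h2gen
    exact ⟨_, a, b, p, hab, rfl⟩
  obtain ⟨a, b, v, hgen, hn⟩ := Nat.find_spec hex
  have hglob : ∀ (g h : G) (u : V), Subgroup.closure {g, h} = ⊤ →
      T.dist v (a • v) + T.dist v (b • v) ≤ T.dist u (g • u) + T.dist u (h • u) :=
    fun g h u hgh => hn ▸ Nat.find_min' hex ⟨g, h, u, hgh, rfl⟩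
  by_cases ha : Odd (T.dist v (a • v))
  · rw [Set.pair_comm] at hgen
    exact isFreeGroup_of_minimal hT hsimp hninv hgen (hno b a · hgen) ha
      fun g h u hgh => by rw [add_comm]; exact hglob g h u hgh
  · exact isFreeGroup_of_minimal hT hsimp hninv hgen (hno a b · hgen)
      (SimpleGraph.odd_dist_smul_of_generating hT hsimp hedge hvtrans hgen
        (Nat.not_odd_iff_even.1 ha) v) hglob

end Minimal

/-- **2-acylindrical HNN splittings.**  Let `G` be a torsion-free, non-free, 2-generated group
acting simplicially, without inversions and 2-acylindrically on a simplicial tree `T` with at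
least one edge, transitively on vertices and transitively on unordered edges.  Then there is a
generating pair `(g, h)`, adjacent vertices `x`, `y`, and `n ≥ 1` with `g ^ n ≠ 1`, such that
`g` fixes `x`, `g ^ n` fixes `y`, and `h` maps `x` to `y` or `y` to `x`. -/
theorem generating_pair_of_vertex_and_edge_transitive_action
    {G V : Type*} [Group G] (T : SimpleGraph V) (hT : T.IsTree)
    [MulAction G V]
    (hsimp : ∀ (g : G) (u v : V), T.Adj u v → T.Adj (g • u) (g • v))
    (hninv : ∀ (g : G) (u v : V), T.Adj u v → ¬(g • u = v ∧ g • v = u))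
    (hacyl : ∀ g : G, g ≠ 1 → ∀ u v : V, g • u = u → g • v = v → T.dist u v ≤ 2)
    (hedge : ∃ u w : V, T.Adj u w)
    (hvtrans : ∀ u v : V, ∃ g : G, g • u = v)
    (hetrans : ∀ u w x y : V, T.Adj u w → T.Adj x y → SameEdgeOrbit G u w x y)
    (htf : ∀ (g : G) (n : ℕ), 1 ≤ n → g ^ n = 1 → g = 1)
    (hnonfree : ¬ IsFreeGroup G)
    (h2gen : ∃ a b : G, Subgroup.closure {a, b} = ⊤) :
    ∃ (g h : G) (x y : V) (n : ℕ),
      Subgroup.closure {g, h} = ⊤ ∧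
      T.Adj x y ∧ 1 ≤ n ∧ g ^ n ≠ 1 ∧
      g • x = x ∧ g ^ n • y = y ∧
      (h • x = y ∨ h • y = x) := by
  rcases isFreeGroup_or_exists_elliptic_generator hT hsimp hninv hedge hvtrans h2gen with
    hfree | ⟨a, b, c, hgen, hc⟩
  · exact absurd hfree hnonfree
  have hb := SimpleGraph.odd_dist_smul_of_generating hT hsimp hedge hvtrans hgen (u := c)
    (by simp [hc])
  by_cases ha : a = 1
  · subst ha
    refine absurd (isFreeGroup_of_closure_singleton htf ?_ hgen) hnonfree
    rintro rfl
    simpa using hb c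
  rcases isFreeGroup_or_linked_of_elliptic hT hsimp hninv hacyl htf hgen ha hc hb with
    hfree | ⟨x, y, n, hadj, hn, hx, hy, hxy⟩
  · exact absurd hfree hnonfree
  · exact ⟨a, b, x, y, n, hgen, hadj, hn, fun h => ha (htf a n hn h), hx, hy, hxy⟩
end

section
/- Let a group G act simplicially and without inversions on a simplicial tree T, let v and w be adjacent vertices, and write e = {v,w} and Stab(e) = {g ∈ G : g·v = v and g·w = w}. Let G_v and G_w be subgroups of G with G_v·v = v and G_w·w = w, and suppose C := G_v ∩ Stab(e) = G_w ∩ Stab(e), with C ≠ G_v and C ≠ G_w. Then the canonical homomorphism from the amalgamated free product G_v *_C G_w to G induced by the inclusions of G_v and G_w is injective; in particular the subgroup of G generated by G_v ∪ G_w is isomorphic to G_v *_C G_w. -/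
/-- A two-element family of types, used to index a binary amalgamated product. -/
def BoolFam (X Y : Type u) : Bool → Type u
  | true => X
  | false => Y

instance instGroupBoolFam (X Y : Type u) [Group X] [Group Y] :
    ∀ b, Group (BoolFam X Y b)
  | true => inferInstanceAs (Group X)
  | false => inferInstanceAs (Group Y)

/-- The two inclusions of a common subgroup, as a `Bool`-indexed family of homomorphisms. -/
def boolFamHom {H : Type*} {X Y : Type u} [Group H] [Group X] [Group Y]
    (f : H →* X) (g : H →* Y) : ∀ b, H →* BoolFam X Y b
  | true => f
  | false => g

/-- The amalgamated free product `X *_H Y` of the maps `f : H →* X` and `g : H →* Y`,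
realized as an indexed pushout. -/
abbrev AmalgamatedProduct {H : Type*} {X Y : Type u} [Group H] [Group X] [Group Y]
    (f : H →* X) (g : H →* Y) : Type _ :=
  Monoid.PushoutI (boolFamHom f g)

/-- The canonical map of the left factor into the amalgamated product. -/
def AmalgamatedProduct.inl {H : Type*} {X Y : Type u} [Group H] [Group X] [Group Y]
    {f : H →* X} {g : H →* Y} : X →* AmalgamatedProduct f g :=
  Monoid.PushoutI.of (φ := boolFamHom f g) true

/-- The canonical map of the right factor into the amalgamated product. -/
def AmalgamatedProduct.inr {H : Type*} {X Y : Type u} [Group H] [Group X] [Group Y]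
    {f : H →* X} {g : H →* Y} : Y →* AmalgamatedProduct f g :=
  Monoid.PushoutI.of (φ := boolFamHom f g) false

namespace Monoid.PushoutI

variable {ι H K X : Type*} {A : ι → Type*} [∀ i, Group (A i)] [Group H] [Group K]
  {φ : ∀ i, H →* A i}

theorem NormalWord.reduced_toWord {d : NormalWord.Transversal φ} (w : NormalWord d) :
    Reduced φ w.toWord := by
  rintro ⟨i, g⟩ hg hr
  refine w.ne_one _ hg ?_
  have h := (Subgroup.IsComplement.coe_equiv_snd_eq_one_iff_mem (d.compl i) (d.one_mem i)).2 hr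
  rwa [((d.compl i).equiv_snd_eq_self_iff_mem (one_mem _)).2 (w.normalized i g hg)] at h

theorem exists_base_mul_reduced (hφ : ∀ i, Function.Injective (φ i)) (x : PushoutI φ) :
    ∃ (h : H) (w : CoprodI.Word A), Reduced φ w ∧ x = base φ h * ofCoprodI w.prod := by
  classical
  obtain ⟨d⟩ := NormalWord.transversal_nonempty φ hφ
  obtain ⟨w, rfl⟩ := (NormalWord.equiv (d := d)).symm.surjective x
  exact ⟨w.head, w.toWord, w.reduced_toWord, rfl⟩

variable [MulAction K X]

theorem Reduced.smul_mem (F : PushoutI φ →* K) {S : ι → Set X}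
    (hS : ∀ i j, i ≠ j → ∀ g ∉ (φ i).range, ∀ x ∈ S j, F (of i g) • x ∈ S i)
    {p : X} (hp : ∀ i, ∀ g ∉ (φ i).range, F (of i g) • p ∈ S i)
    {w : CoprodI.Word A} (hw : Reduced φ w) {i : ι} (hi : w.fstIdx = some i) :
    F (ofCoprodI w.prod) • p ∈ S i := by
  induction w using CoprodI.Word.consRecOn generalizing i with
  | empty => simp [CoprodI.Word.fstIdx, CoprodI.Word.empty] at hi
  | cons j g w h1 h2 ih =>
    obtain rfl : j = i := by simpa using hi
    have hg : g ∉ (φ j).range := hw ⟨j, g⟩ (by simp [CoprodI.Word.cons])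
    have hw' : Reduced φ w := fun l hl => hw l (by simp [CoprodI.Word.cons, hl])
    rw [CoprodI.Word.prod_cons, map_mul, map_mul, ofCoprodI_of, mul_smul]
    rcases hk : w.fstIdx with _ | k
    · obtain rfl : w = .empty := by
        ext1
        simpa [CoprodI.Word.fstIdx] using hk
      simpa using hp j g hg
    · exact hS j k (fun h => h1 (h ▸ hk)) g hg _ (ih hw' hk)

/-- **Ping-pong** for amalgamated products. -/
theorem injective_of_ping_pong (hφ : ∀ i, Function.Injective (φ i)) (F : PushoutI φ →* K)
    (hF : Function.Injective (F.comp (base φ))) {S : ι → Set X}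
    (hS : ∀ i j, i ≠ j → ∀ g ∉ (φ i).range, ∀ x ∈ S j, F (of i g) • x ∈ S i)
    (hp : ∀ i, ∃ p ∉ S i, (∀ h, F (base φ h) • p = p) ∧
      ∀ j, ∀ g ∉ (φ j).range, F (of j g) • p ∈ S j) :
    Function.Injective F := by
  refine (injective_iff_map_eq_one F).2 fun x hx => ?_
  obtain ⟨h, w, hw, rfl⟩ := exists_base_mul_reduced hφ x
  rcases hk : w.fstIdx with _ | i
  · obtain rfl : w = .empty := by
      ext1
      simpa [CoprodI.Word.fstIdx] using hk
    have : h = 1 := (injective_iff_map_eq_one _).1 hF h (by simpa using hx)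
    simp [this]
  · obtain ⟨p, hpi, hph, hpj⟩ := hp i
    refine absurd (hw.smul_mem F hS hpj hk) ?_
    rw [map_mul] at hx
    rw [eq_inv_of_mul_eq_one_right hx, inv_smul_eq_iff.2 (hph h).symm]
    exact hpi

end Monoid.PushoutI

namespace SimpleGraph

variable {V : Type*} {T : SimpleGraph V}

theorem IsTree.eq_of_adj_of_dist_lt (hT : T.IsTree) {u v a b : V} (ha : T.Adj v a)
    (hb : T.Adj v b) (hua : T.dist u a < T.dist u v) (hub : T.dist u b < T.dist u v) : a = b := by
  obtain ⟨p, hp, hpl⟩ := hT.connected.exists_path_of_dist u v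
  have key {c : V} (hc : T.Adj v c) (huc : T.dist u c < T.dist u v) : c = p.penultimate := by
    obtain ⟨q, hq, hql⟩ := hT.connected.exists_path_of_dist u c
    refine hT.isAcyclic.eq_penultimate_of_adj_end hp hc
      (hT.isAcyclic.mem_support_of_ne_mem_support_of_adj_of_isPath hp hq hc fun hv => ?_)
    have := congrArg Walk.length (hT.isAcyclic.path_concat hp hq hc hv)
    rw [Walk.length_concat] at this
    omega
  rw [key ha hua, key hb hub]

variable {G : Type*} [Group G] [MulAction G V]

theorem dist_smul_smul (hT : T.Connected)
    (h : ∀ (g : G) (u v : V), T.Adj u v → T.Adj (g • u) (g • v))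
    (g : G) (u v : V) : T.dist (g • u) (g • v) = T.dist u v := by
  have key (g : G) (u v : V) : T.dist (g • u) (g • v) ≤ T.dist u v := by
    obtain ⟨p, hp⟩ := hT.exists_walk_length_eq_dist u v
    let f : T →g T := ⟨fun x => g • x, fun {a b} hab => h g a b hab⟩
    exact (dist_le (p.map f)).trans_eq ((p.length_map f).trans hp)
  refine (key g u v).antisymm ?_
  simpa using key g⁻¹ (g • u) (g • v)

/-- An element fixing `a` but not its neighbour `b` maps the half-tree on the `b`-side of the edge
into the half-tree on the `a`-side. -/
theorem IsTree.dist_smul_lt (hT : T.IsTree)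
    (h : ∀ (g : G) (u v : V), T.Adj u v → T.Adj (g • u) (g • v)) {a b : V} (hab : T.Adj a b)
    {g : G} (ha : g • a = a) (hb : g • b ≠ b) {u : V} (hu : T.dist u b < T.dist u a) :
    T.dist (g • u) a < T.dist (g • u) b := by
  rcases (hT.dist_ne_of_adj (g • u) hab).lt_or_gt with h1 | h1
  · exact h1
  · refine absurd
      (hT.eq_of_adj_of_dist_lt (u := g • u) (by simpa [ha] using h g a b hab) hab ?_ h1) hb
    rw [dist_smul_smul hT.connected h]
    conv_rhs => rw [← ha]
    rwa [dist_smul_smul hT.connected h]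

end SimpleGraph

/-- **Subgroups generated by two vertex groups along an edge** (Proposition on controlled
splittings, case (1)).  If `G` acts simplicially without inversions on a tree, `e = {v,w}`
is an edge, `G_v` fixes `v`, `G_w` fixes `w`, and
`C := G_v ∩ Stab(e) = G_w ∩ Stab(e)` is proper in both `G_v` and `G_w`, then the canonical
homomorphism `G_v *_C G_w → G` is injective, so `⟨G_v ∪ G_w⟩ ≅ G_v *_C G_w`. -/
theorem amalgam_of_vertex_groups_embeds
    {G V : Type*} [Group G] (T : SimpleGraph V) (hT : T.IsTree)
    [MulAction G V]
    (hsimp : ∀ (g : G) (u v : V), T.Adj u v → T.Adj (g • u) (g • v))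
    (hninv : ∀ (g : G) (u v : V), T.Adj u v → ¬(g • u = v ∧ g • v = u))
    (v w : V) (hvw : T.Adj v w)
    (Gv Gw : Subgroup G)
    (hGv : ∀ g ∈ Gv, g • v = v) (hGw : ∀ g ∈ Gw, g • w = w)
    (hC : Gv ⊓ (MulAction.stabilizer G v ⊓ MulAction.stabilizer G w) =
          Gw ⊓ (MulAction.stabilizer G v ⊓ MulAction.stabilizer G w))
    (hCv : Gv ⊓ (MulAction.stabilizer G v ⊓ MulAction.stabilizer G w) ≠ Gv)
    (hCw : Gw ⊓ (MulAction.stabilizer G v ⊓ MulAction.stabilizer G w) ≠ Gw) :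
    ∃ F : AmalgamatedProduct
        (Subgroup.inclusion (inf_le_left :
          Gv ⊓ (MulAction.stabilizer G v ⊓ MulAction.stabilizer G w) ≤ Gv))
        (Subgroup.inclusion (hC.le.trans inf_le_left :
          Gv ⊓ (MulAction.stabilizer G v ⊓ MulAction.stabilizer G w) ≤ Gw)) →* G,
      (∀ x : Gv, F (AmalgamatedProduct.inl x) = (x : G)) ∧
      (∀ y : Gw, F (AmalgamatedProduct.inr y) = (y : G)) ∧
      Function.Injective F := by
  have hCle : Gv ⊓ (MulAction.stabilizer G v ⊓ MulAction.stabilizer G w) ≤ Gw :=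
    hC.le.trans inf_le_left
  let φl := Subgroup.inclusion (inf_le_left :
    Gv ⊓ (MulAction.stabilizer G v ⊓ MulAction.stabilizer G w) ≤ Gv)
  let φr := Subgroup.inclusion hCle
  have hφ : ∀ b, Function.Injective (boolFamHom φl φr b) := by
    rintro (_ | _)
    · exact Subgroup.inclusion_injective hCle
    · exact Subgroup.inclusion_injective inf_le_left
  let f : ∀ b, BoolFam Gv Gw b →* G
    | true => Gv.subtype
    | false => Gw.subtype
  let F := Monoid.PushoutI.lift (φ := boolFamHom φl φr) f (Subgroup.subtype _)
    (by rintro (_ | _) <;> rfl)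
  have hFl (x : Gv) : F (.of true x) = (x : G) := Monoid.PushoutI.lift_of ..
  have hFr (y : Gw) : F (.of false y) = (y : G) := Monoid.PushoutI.lift_of ..
  have hFb (c) : F (.base _ c) = (c : G) := Monoid.PushoutI.lift_base ..
  have hl (x : Gv) (hx : x ∉ φl.range) : (x : G) • w ≠ w := fun hw =>
    hx ⟨⟨x, x.2, hGv x x.2, hw⟩, rfl⟩
  have hr (y : Gw) (hy : y ∉ φr.range) : (y : G) • v ≠ v := fun hv =>
    hy ⟨⟨y, hC.ge ⟨y.2, hv, hGw y y.2⟩⟩, rfl⟩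
  have hv : T.dist v v < T.dist v w := by simp [SimpleGraph.dist_eq_one_iff_adj.2 hvw]
  have hw : T.dist w w < T.dist w v := by simp [SimpleGraph.dist_eq_one_iff_adj.2 hvw.symm]
  let S : Bool → Set V
    | true => {u | T.dist u v < T.dist u w}
    | false => {u | T.dist u w < T.dist u v}
  have hSl (x : Gv) (hx : (x : G) • w ≠ w) (u : V) (hu : u ∈ S false) : (x : G) • u ∈ S true :=
    hT.dist_smul_lt hsimp hvw (hGv x x.2) hx hu
  have hSr (y : Gw) (hy : (y : G) • v ≠ v) (u : V) (hu : u ∈ S true) : (y : G) • u ∈ S false :=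
    hT.dist_smul_lt hsimp hvw.symm (hGw y y.2) hy hu
  have hvS : v ∈ S true := hv
  have hwS : w ∈ S false := hw
  refine ⟨F, hFl, hFr, Monoid.PushoutI.injective_of_ping_pong hφ F (S := S) ?_ ?_ ?_⟩
  · intro a b hab
    exact Subtype.ext ((hFb a).symm.trans (hab.trans (hFb b)))
  · rintro (_ | _) (_ | _) hij g hg u hu
    · exact absurd rfl hij
    · exact (hFr g).symm ▸ hSr g (hr g hg) u hu
    · exact (hFl g).symm ▸ hSl g (hl g hg) u hu
    · exact absurd rfl hij
  · rintro (_ | _)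
    · refine ⟨v, hv.not_gt, fun c => (hFb c).symm ▸ c.2.2.1, ?_⟩
      rintro (_ | _) g hg
      · exact (hFr g).symm ▸ hSr g (hr g hg) v hvS
      · exact (hFl g).symm ▸ (hGv _ g.2).symm ▸ hvS
    · refine ⟨w, hw.not_gt, fun c => (hFb c).symm ▸ c.2.2.2, ?_⟩
      rintro (_ | _) g hg
      · exact (hFr g).symm ▸ (hGw _ g.2).symm ▸ hwS
      · exact (hFl g).symm ▸ hSl g (hl g hg) w hwS
end

section
/- Let a group G act simplicially and without inversions on a simplicial tree T. Let e₁ = {v,w} and e₂ = {v,z} be two distinct edges at a vertex v, with Stab(e₁) = {g : g·v = v, g·w = w} and Stab(e₂) = {g : g·v = v, g·z = z}. Let G_v, G_w, G_z be subgroups of G fixing v, w, z respectively, and suppose C₁ := G_v ∩ Stab(e₁) = G_w ∩ Stab(e₁) with C₁ ≠ G_w, C₂ := G_v ∩ Stab(e₂) = G_z ∩ Stab(e₂) with C₂ ≠ G_z, and that there is no a ∈ G_v with a·w = z. Then the canonical homomorphism from the iterated amalgamated free product G_w *_{C₁} G_v *_{C₂} G_z to G, induced by the inclusions of G_v, G_w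 and G_z, is injective; in particular the subgroup of G generated by G_v ∪ G_w ∪ G_z is isomorphic to G_w *_{C₁} G_v *_{C₂} G_z. -/
namespace Monoid.PushoutI

variable {ι : Type*} {A : ι → Type*} {H : Type*} [∀ i, Group (A i)] [Group H] {φ : ∀ i, H →* A i}

/-- `IsReduced i p` says that `p` is a nonempty product of factors lying outside the
amalgamated subgroup, with consecutive factors from distinct groups and the first one
from the group of index `i`. -/
inductive IsReduced : ι → PushoutI φ → Prop
  | single (i : ι) (a : A i) : a ∉ (φ i).range → IsReduced i (of i a)
  | cons (i j : ι) (a : A i) (p : PushoutI φ) :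
      i ≠ j → a ∉ (φ i).range → IsReduced j p → IsReduced i (PushoutI.of i a * p)

theorem IsReduced.base_mul {i : ι} {p : PushoutI φ} (hp : IsReduced i p) (h : H) :
    IsReduced i (base φ h * p) := by
  have key (a : A i) (ha : a ∉ (φ i).range) : φ i h * a ∉ (φ i).range := by
    rwa [Subgroup.mul_mem_cancel_left _ (MonoidHom.mem_range.2 ⟨h, rfl⟩)]
  cases hp with
  | single _ a ha =>
    rw [← of_apply_eq_base φ i, ← map_mul]
    exact .single i _ (key a ha)
  | cons _ j a q hij ha hq =>
    rw [← of_apply_eq_base φ i, ← mul_assoc, ← map_mul]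
    exact .cons i j _ q hij (key a ha) hq

theorem IsReduced.of_mul {i : ι} {p : PushoutI φ} (hp : IsReduced i p) (j : ι) (a : A j) :
    (∃ h, base φ h = of j a * p) ∨ ∃ k, IsReduced k (of j a * p) := by
  by_cases ha : a ∈ (φ j).range
  · obtain ⟨h, rfl⟩ := ha
    rw [of_apply_eq_base φ]
    exact .inr ⟨i, hp.base_mul h⟩
  by_cases hji : j = i
  · subst hji
    cases hp with
    | single _ b hb =>
      rw [← map_mul]
      by_cases hab : a * b ∈ (φ j).range
      · obtain ⟨h, hh⟩ := hab
        exact .inl ⟨h, by rw [← hh, of_apply_eq_base φ]⟩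
      · exact .inr ⟨j, .single j _ hab⟩
    | cons _ k b q hjk hb hq =>
      rw [← mul_assoc, ← map_mul]
      by_cases hab : a * b ∈ (φ j).range
      · obtain ⟨h, hh⟩ := hab
        rw [← hh, of_apply_eq_base φ]
        exact .inr ⟨k, hq.base_mul h⟩
      · exact .inr ⟨j, .cons j k _ q hjk hab hq⟩
  · exact .inr ⟨j, .cons j i a p hji ha hp⟩

/-- Every element of an amalgamated product lies in the base or is a reduced product. -/
theorem mem_range_base_or_isReduced (p : PushoutI φ) :
    (∃ h, base φ h = p) ∨ ∃ i, IsReduced i p := by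
  suffices key : ∀ p q : PushoutI φ, ((∃ h, base φ h = q) ∨ ∃ i, IsReduced i q) →
      ((∃ h, base φ h = p * q) ∨ ∃ i, IsReduced i (p * q)) by
    simpa using key p 1 (.inl ⟨1, map_one _⟩)
  intro p
  induction p using PushoutI.induction_on with
  | of i a =>
    rintro q (⟨h, rfl⟩ | ⟨j, hq⟩)
    · rw [← of_apply_eq_base φ i, ← map_mul]
      by_cases hab : a * φ i h ∈ (φ i).range
      · obtain ⟨k, hk⟩ := hab
        exact .inl ⟨k, by rw [← hk, of_apply_eq_base φ]⟩
      · exact .inr ⟨i, .single i _ hab⟩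
    · exact hq.of_mul i a
  | base h =>
    rintro q (⟨k, rfl⟩ | ⟨j, hq⟩)
    · exact .inl ⟨h * k, map_mul _ _ _⟩
    · exact .inr ⟨j, hq.base_mul h⟩
  | mul x y hx hy =>
    intro q hq
    rw [mul_assoc]
    exact hx _ (hy _ hq)

end Monoid.PushoutI

namespace AmalgamatedProduct

variable {H : Type*} {X Y : Type u} [Group H] [Group X] [Group Y] {f : H →* X} {g : H →* Y}

/-- The homomorphism out of an amalgamated product induced by two compatible homomorphisms. -/
def lift {K : Type*} [Monoid K] (a : X →* K) (b : Y →* K) (h : a.comp f = b.comp g) :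
    AmalgamatedProduct f g →* K :=
  Monoid.PushoutI.lift (φ := boolFamHom f g) (fun | true => a | false => b) (a.comp f)
    (fun | true => rfl | false => h.symm)

theorem lift_inl {K : Type*} [Monoid K] (a : X →* K) (b : Y →* K) (h : a.comp f = b.comp g)
    (x : X) : lift a b h (inl x) = a x :=
  Monoid.PushoutI.lift_of (φ := boolFamHom f g) (i := true) _ _ _ x

theorem lift_inr {K : Type*} [Monoid K] (a : X →* K) (b : Y →* K) (h : a.comp f = b.comp g)
    (y : Y) : lift a b h (inr y) = b y :=
  Monoid.PushoutI.lift_of (φ := boolFamHom f g) (i := false) _ _ _ y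

theorem inl_apply_eq_inr_apply (h : H) :
    (inl (f h) : AmalgamatedProduct f g) = inr (g h) :=
  (Monoid.PushoutI.of_apply_eq_base (boolFamHom f g) true h).trans
    (Monoid.PushoutI.of_apply_eq_base (boolFamHom f g) false h).symm

/-- Induction on reduced products: `L` and `R` are predicates on reduced products starting in
the left and in the right factor. -/
theorem reduced_induction {L R : AmalgamatedProduct f g → Prop}
    (inl_mem : ∀ x ∉ f.range, L (inl x)) (inr_mem : ∀ y ∉ g.range, R (inr y))
    (inl_mul : ∀ x ∉ f.range, ∀ q, R q → L (inl x * q))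
    (inr_mul : ∀ y ∉ g.range, ∀ q, L q → R (inr y * q)) (p : AmalgamatedProduct f g) :
    (∃ h, inl (f h) = p) ∨ L p ∨ R p := by
  rcases Monoid.PushoutI.mem_range_base_or_isReduced p with ⟨h, rfl⟩ | ⟨i, hp⟩
  · exact .inl ⟨h, Monoid.PushoutI.of_apply_eq_base (boolFamHom f g) true h⟩
  · have key : bif i then L p else R p := by
      induction hp with
      | single i a ha =>
        cases i
        · exact inr_mem a ha
        · exact inl_mem a ha
      | cons i j a q hij ha _ ih =>
        cases i <;> cases j
        · exact absurd rfl hij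
        · exact inr_mul a ha q ih
        · exact inl_mul a ha q ih
        · exact absurd rfl hij
    cases i
    · exact .inr (.inr key)
    · exact .inr (.inl key)

/-- Ping-pong criterion for a homomorphism out of an amalgamated product to be injective. -/
theorem injective_of_pingPong {G V : Type*} [Group G] [MulAction G V]
    (F : AmalgamatedProduct f g →* G) (S : Set V) {s t : V} (hs : s ∈ S) (ht : t ∉ S)
    (hl : ∀ x ∉ f.range, ∀ p ∉ S, F (inl x) • p ∈ S ∧ F (inl x) • p ≠ s)
    (hr : ∀ y ∉ g.range, ∀ p ∈ S, F (inr y) • p ∉ S ∧ F (inr y) • p ≠ t)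
    (hbase : ∀ h, F (inl (f h)) = 1 → f h = 1) : Function.Injective F := by
  rw [injective_iff_map_eq_one]
  intro p hp
  rcases reduced_induction
    (L := fun p => ∃ q, (q = s ∨ q = t) ∧ F p • q ∈ S ∧ F p • q ≠ s)
    (R := fun p => ∃ q, (q = s ∨ q = t) ∧ F p • q ∉ S ∧ F p • q ≠ t)
    (fun x hx => ⟨t, .inr rfl, hl x hx t ht⟩) (fun y hy => ⟨s, .inl rfl, hr y hy s hs⟩)
    (fun x hx q ⟨r, h, hq, _⟩ => ⟨r, h, by simpa [mul_smul] using hl x hx _ hq⟩)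
    (fun y hy q ⟨r, h, hq, _⟩ => ⟨r, h, by simpa [mul_smul] using hr y hy _ hq⟩) p
    with ⟨h, rfl⟩ | ⟨q, hq, h⟩ | ⟨q, hq, h⟩
  · rw [hbase h hp, map_one]
  all_goals
    rw [hp, one_smul] at h
    rcases hq with rfl | rfl
    · tauto
    · tauto

end AmalgamatedProduct

namespace SimpleGraph

variable {V : Type*} {T : SimpleGraph V}

/-- The vertices closer to `b` than to its neighbour `a`. -/
def branch_s6 (T : SimpleGraph V) (a b : V) : Set V := {x | T.dist x a = T.dist x b + 1}

theorem left_notMem_branch (a b : V) : a ∉ T.branch_s6 a b := by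
  simp [branch_s6]

theorem right_mem_branch {a b : V} (h : T.Adj a b) : b ∈ T.branch_s6 a b := by
  simp [branch_s6, dist_eq_one_iff_adj.2 h.symm]

theorem IsTree.compl_branch (hT : T.IsTree) {a b : V} (h : T.Adj a b) :
    (T.branch_s6 a b)ᶜ = T.branch_s6 b a := by
  ext x
  have := hT.dist_eq_dist_add_one_of_adj x h
  simp only [branch_s6, Set.mem_compl_iff, Set.mem_ofPred_eq]
  omega

theorem IsTree.notMem_branch_of_ne (hT : T.IsTree) {a b c x : V} (hb : T.Adj a b)
    (hc : T.Adj a c) (hbc : b ≠ c) (hx : x ∈ T.branch_s6 a b) : x ∉ T.branch_s6 a c := by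
  intro hx'
  have key {d : V} (hd : T.Adj a d) (h : x ∈ T.branch_s6 a d) :
      ∃ p : T.Walk a x, p.IsPath ∧ p.snd = d := by
    obtain ⟨p, hp⟩ := (hT.connected d x).exists_walk_length_eq_dist
    refine ⟨.cons hd p, Walk.isPath_of_length_eq_dist _ ?_, by simp⟩
    rw [Walk.length_cons, hp, dist_comm (u := a), dist_comm (u := d)]
    exact h.symm
  obtain ⟨p, hp, rfl⟩ := key hb hx
  obtain ⟨q, hq, rfl⟩ := key hc hx'
  exact hbc (by rw [(hT.existsUnique_path a x).unique hp hq])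

section Action

variable {G : Type*} [Group G] [MulAction G V]

theorem dist_smul_le (hT : T.Connected)
    (hsimp : ∀ (g : G) (u v : V), T.Adj u v → T.Adj (g • u) (g • v)) (g : G) (x y : V) :
    T.dist (g • x) (g • y) ≤ T.dist x y := by
  obtain ⟨p, hp⟩ := (hT x y).exists_walk_length_eq_dist
  rw [← hp, ← Walk.length_map (⟨(g • ·), hsimp g _ _⟩ : T →g T) p]
  exact dist_le _

theorem dist_smul (hT : T.Connected)
    (hsimp : ∀ (g : G) (u v : V), T.Adj u v → T.Adj (g • u) (g • v)) (g : G) (x y : V) :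
    T.dist (g • x) (g • y) = T.dist x y :=
  (dist_smul_le hT hsimp g x y).antisymm
    (by simpa using dist_smul_le hT hsimp g⁻¹ (g • x) (g • y))

theorem smul_mem_branch (hT : T.Connected)
    (hsimp : ∀ (g : G) (u v : V), T.Adj u v → T.Adj (g • u) (g • v)) {g : G} {a b x : V}
    (hg : g • a = a) (hx : x ∈ T.branch_s6 a b) : g • x ∈ T.branch_s6 a (g • b) := by
  unfold branch_s6 at *
  rw [Set.mem_ofPred_eq, dist_smul hT hsimp]
  nth_rewrite 1 [← hg]
  rwa [dist_smul hT hsimp]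

/-- A group element fixing `a` moves the branch at `a` through `b` off the branch through `c`,
provided it does not map `b` to `c`. -/
theorem IsTree.smul_notMem_branch (hT : T.IsTree)
    (hsimp : ∀ (g : G) (u v : V), T.Adj u v → T.Adj (g • u) (g • v)) {g : G} {a b c x : V}
    (hg : g • a = a) (hb : T.Adj a b) (hc : T.Adj a c) (hbc : g • b ≠ c)
    (hx : x ∈ T.branch_s6 a b) : g • x ∉ T.branch_s6 a c ∧ g • x ≠ a := by
  have h := smul_mem_branch hT.connected hsimp hg hx
  refine ⟨hT.notMem_branch_of_ne (by simpa [hg] using hsimp g a b hb) hc hbc h, fun h' => ?_⟩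
  exact left_notMem_branch a _ (h' ▸ h)

end Action

end SimpleGraph

/-- **Subgroups generated by three vertex groups along two edges** (Proposition on controlled
splittings, case (2)).  If `G` acts simplicially without inversions on a tree,
`e₁ = {v,w}` and `e₂ = {v,z}` are distinct edges, `G_v, G_w, G_z` fix `v, w, z`,
`C₁ := G_v ∩ Stab(e₁) = G_w ∩ Stab(e₁)` is proper in `G_w`,
`C₂ := G_v ∩ Stab(e₂) = G_z ∩ Stab(e₂)` is proper in `G_z`, and no element of `G_v`
maps `w` to `z`, then the canonical homomorphism
`(G_w *_{C₁} G_v) *_{C₂} G_z → G` is injective, so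
`⟨G_v ∪ G_w ∪ G_z⟩ ≅ G_w *_{C₁} G_v *_{C₂} G_z`. -/
theorem iterated_amalgam_of_vertex_groups_embeds
    {G V : Type*} [Group G] (T : SimpleGraph V) (hT : T.IsTree)
    [MulAction G V]
    (hsimp : ∀ (g : G) (u v : V), T.Adj u v → T.Adj (g • u) (g • v))
    (hninv : ∀ (g : G) (u v : V), T.Adj u v → ¬(g • u = v ∧ g • v = u))
    (v w z : V) (hvw : T.Adj v w) (hvz : T.Adj v z) (hwz : w ≠ z)
    (Gv Gw Gz : Subgroup G)
    (hGv : ∀ g ∈ Gv, g • v = v) (hGw : ∀ g ∈ Gw, g • w = w) (hGz : ∀ g ∈ Gz, g • z = z)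
    (hC₁ : Gv ⊓ (MulAction.stabilizer G v ⊓ MulAction.stabilizer G w) =
           Gw ⊓ (MulAction.stabilizer G v ⊓ MulAction.stabilizer G w))
    (hC₁w : Gw ⊓ (MulAction.stabilizer G v ⊓ MulAction.stabilizer G w) ≠ Gw)
    (hC₂ : Gv ⊓ (MulAction.stabilizer G v ⊓ MulAction.stabilizer G z) =
           Gz ⊓ (MulAction.stabilizer G v ⊓ MulAction.stabilizer G z))
    (hC₂z : Gz ⊓ (MulAction.stabilizer G v ⊓ MulAction.stabilizer G z) ≠ Gz)
    (hdiff : ¬ ∃ a ∈ Gv, a • w = z) :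
    ∃ F : AmalgamatedProduct
        (MonoidHom.comp
          (AmalgamatedProduct.inr :
            ↥Gv →* AmalgamatedProduct
              (Subgroup.inclusion (hC₁.le.trans inf_le_left :
                Gv ⊓ (MulAction.stabilizer G v ⊓ MulAction.stabilizer G w) ≤ Gw))
              (Subgroup.inclusion (inf_le_left :
                Gv ⊓ (MulAction.stabilizer G v ⊓ MulAction.stabilizer G w) ≤ Gv)))
          (Subgroup.inclusion (inf_le_left :
            Gv ⊓ (MulAction.stabilizer G v ⊓ MulAction.stabilizer G z) ≤ Gv)))
        (Subgroup.inclusion (hC₂.le.trans inf_le_left :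
          Gv ⊓ (MulAction.stabilizer G v ⊓ MulAction.stabilizer G z) ≤ Gz)) →* G,
      (∀ x : Gw, F (AmalgamatedProduct.inl (AmalgamatedProduct.inl x)) = (x : G)) ∧
      (∀ x : Gv, F (AmalgamatedProduct.inl (AmalgamatedProduct.inr x)) = (x : G)) ∧
      (∀ y : Gz, F (AmalgamatedProduct.inr y) = (y : G)) ∧
      Function.Injective F := by
  have h_compl := hT.compl_branch hvw
  have hfix₁ : ∀ x : Gv, (x : G) • w = w → x ∈ (Subgroup.inclusion (inf_le_left :
      Gv ⊓ (MulAction.stabilizer G v ⊓ MulAction.stabilizer G w) ≤ Gv)).range := fun x hx =>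
    ⟨⟨x, x.2, hGv x x.2, hx⟩, rfl⟩
  have hfix₂ : ∀ x : Gv, (x : G) • z = z → x ∈ (Subgroup.inclusion (inf_le_left :
      Gv ⊓ (MulAction.stabilizer G v ⊓ MulAction.stabilizer G z) ≤ Gv)).range := fun x hx =>
    ⟨⟨x, x.2, hGv x x.2, hx⟩, rfl⟩
  have hfixw : ∀ x : Gw, (x : G) • v = v → x ∈ (Subgroup.inclusion (hC₁.le.trans inf_le_left :
      Gv ⊓ (MulAction.stabilizer G v ⊓ MulAction.stabilizer G w) ≤ Gw)).range := fun x hx =>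
    ⟨⟨x, hC₁.ge ⟨x.2, hx, hGw x x.2⟩⟩, rfl⟩
  have hfixz : ∀ x : Gz, (x : G) • v = v → x ∈ (Subgroup.inclusion (hC₂.le.trans inf_le_left :
      Gv ⊓ (MulAction.stabilizer G v ⊓ MulAction.stabilizer G z) ≤ Gz)).range := fun x hx =>
    ⟨⟨x, hC₂.ge ⟨x.2, hx, hGz x x.2⟩⟩, rfl⟩
  have hwz' : ∀ b ∈ Gv, b • z ≠ w := fun b hb h =>
    hdiff ⟨b⁻¹, inv_mem hb, by rw [← h, inv_smul_smul]⟩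
  let F₁ := AmalgamatedProduct.lift
    (f := Subgroup.inclusion (hC₁.le.trans inf_le_left :
      Gv ⊓ (MulAction.stabilizer G v ⊓ MulAction.stabilizer G w) ≤ Gw))
    (g := Subgroup.inclusion (inf_le_left :
      Gv ⊓ (MulAction.stabilizer G v ⊓ MulAction.stabilizer G w) ≤ Gv))
    Gw.subtype Gv.subtype rfl
  have hF₁l (x : Gw) : F₁ (AmalgamatedProduct.inl x) = x := AmalgamatedProduct.lift_inl _ _ _ x
  have hF₁r (x : Gv) : F₁ (AmalgamatedProduct.inr x) = x := AmalgamatedProduct.lift_inr _ _ _ x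
  have hw_move (x : Gw) (hx : x ∉ (Subgroup.inclusion (hC₁.le.trans inf_le_left :
      Gv ⊓ (MulAction.stabilizer G v ⊓ MulAction.stabilizer G w) ≤ Gw)).range) (p : V)
      (hp : p ∉ T.branch_s6 v w) : (x : G) • p ∈ T.branch_s6 v w ∧ (x : G) • p ≠ w := by
    rw [← Set.mem_compl_iff, h_compl] at hp
    have := hT.smul_notMem_branch hsimp (hGw x x.2) hvw.symm hvw.symm (mt (hfixw x) hx) hp
    rwa [← h_compl, Set.mem_compl_iff, not_not] at this
  have hF₁ : Function.Injective F₁ := by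
    refine AmalgamatedProduct.injective_of_pingPong F₁ (T.branch_s6 v w)
      (SimpleGraph.right_mem_branch hvw) (SimpleGraph.left_notMem_branch v w) ?_ ?_ ?_
    · intro x hx p hp
      rw [hF₁l]
      exact hw_move x hx p hp
    · intro x hx p hp
      rw [hF₁r]
      exact hT.smul_notMem_branch hsimp (hGv x x.2) hvw hvw (mt (hfix₁ x) hx) hp
    · intro h hh
      rw [hF₁l] at hh
      exact Subtype.ext hh
  have hz_move (b : Gv) (p : V) (hp : p ∈ T.branch_s6 v z) : (b : G) • p ∉ T.branch_s6 v w :=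
    (hT.smul_notMem_branch hsimp (hGv b b.2) hvz hvw (hwz' b b.2) hp).1
  have hw_off (b : Gv) (p : V) (hp : p ∈ T.branch_s6 v w) :
      (b : G) • p ∉ T.branch_s6 v z ∧ (b : G) • p ≠ v :=
    hT.smul_notMem_branch hsimp (hGv b b.2) hvw hvz (fun h => hdiff ⟨b, b.2, h⟩) hp
  have hA (a) : (∃ b : Gv, AmalgamatedProduct.inr b = a) ∨
      ∀ p ∈ T.branch_s6 v z, F₁ a • p ∉ T.branch_s6 v z ∧ F₁ a • p ≠ v := by
    refine (AmalgamatedProduct.reduced_induction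
      (L := fun a => ∀ p ∈ T.branch_s6 v z, F₁ a • p ∈ T.branch_s6 v w)
      (R := fun a => (∀ p ∈ T.branch_s6 v z, F₁ a • p ∉ T.branch_s6 v w) ∧
        ((∃ b : Gv, AmalgamatedProduct.inr b = a) ∨
          ∀ p ∈ T.branch_s6 v z, F₁ a • p ∉ T.branch_s6 v z ∧ F₁ a • p ≠ v)) ?_ ?_ ?_ ?_ a).elim
      (fun ⟨h, hh⟩ => .inl ⟨_, (AmalgamatedProduct.inl_apply_eq_inr_apply h).symm.trans hh⟩)
      (Or.rec (fun h => .inr fun p hp => by simpa using hw_off 1 _ (h p hp)) And.right)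
    · intro x hx p hp
      rw [hF₁l]
      exact (hw_move x hx p (by simpa using hz_move 1 p hp)).1
    · intro b _
      refine ⟨fun p hp => ?_, .inl ⟨b, rfl⟩⟩
      rw [hF₁r]
      exact hz_move b p hp
    · intro x hx q hq p hp
      rw [map_mul, mul_smul, hF₁l]
      exact (hw_move x hx _ (hq.1 p hp)).1
    · intro b hb q hq
      simp only [map_mul, mul_smul, hF₁r]
      exact ⟨fun p hp => (hT.smul_notMem_branch hsimp (hGv b b.2) hvw hvw
        (mt (hfix₁ b) hb) (hq p hp)).1, .inr fun p hp => hw_off b _ (hq p hp)⟩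
  refine ⟨AmalgamatedProduct.lift F₁ Gz.subtype ?_, fun x => ?_, fun x => ?_,
    AmalgamatedProduct.lift_inr _ _ _, ?_⟩
  · ext x
    exact hF₁r _
  · rw [AmalgamatedProduct.lift_inl, hF₁l]
  · rw [AmalgamatedProduct.lift_inl, hF₁r]
  · refine AmalgamatedProduct.injective_of_pingPong _ (T.branch_s6 z v)
      (SimpleGraph.right_mem_branch hvz.symm) (SimpleGraph.left_notMem_branch z v) ?_ ?_ ?_
    · intro a ha p hp
      rw [AmalgamatedProduct.lift_inl]
      rw [← Set.mem_compl_iff, hT.compl_branch hvz.symm] at hp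
      rw [← hT.compl_branch hvz, Set.mem_compl_iff]
      rcases hA a with ⟨b, rfl⟩ | h
      · rw [hF₁r]
        refine hT.smul_notMem_branch hsimp (hGv b b.2) hvz hvz (fun hb => ha ?_) hp
        obtain ⟨c, rfl⟩ := hfix₂ b hb
        exact ⟨c, rfl⟩
      · exact h p hp
    · intro x hx p hp
      rw [AmalgamatedProduct.lift_inr]
      exact hT.smul_notMem_branch hsimp (hGz x x.2) hvz.symm hvz.symm (mt (hfixz x) hx) hp
    · intro h hh
      rw [AmalgamatedProduct.lift_inl] at hh
      exact hF₁ (hh.trans (map_one F₁).symm)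
end

section
/- Let a group G act simplicially and without inversions on a simplicial tree T, let v and w be adjacent vertices, write e = {v,w} and Stab(e) = {g ∈ G : g·v = v and g·w = w}. Let G_v and G_w be subgroups fixing v and w respectively, and let h ∈ G satisfy h·v = w and h⁻¹G_w h = G_v. Suppose C := G_v ∩ Stab(e) = G_w ∩ Stab(e). Then (noting h⁻¹Ch ≤ G_v and C ≤ G_v) the canonical homomorphism into G from the HNN extension of G_v along the isomorphism h⁻¹Ch → C given by k ↦ hkh⁻¹, sending the stable letter to h and G_v to itself, is injective; in particular the subgroup of G generated by G_v ∪ {h} is isomorphic to the HNN extension of G_v along C. -/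
open HNNExtension

/-- In a tree with a simplicial action, if each `g` in a list moves `v` to a neighbour, and
consecutive letters never backtrack, then the translates of `v` trace out a path. -/
theorem SimpleGraph.IsAcyclic.exists_isPath_prod_smul {G V : Type*} [Group G] {T : SimpleGraph V}
    (hT : T.IsAcyclic) [MulAction G V]
    (hsimp : ∀ (g : G) (u v : V), T.Adj u v → T.Adj (g • u) (g • v)) (v : V) (l : List G)
    (hadj : ∀ g ∈ l, T.Adj v (g • v)) (hchain : l.IsChain fun a b => (a * b) • v ≠ v)
    (x : V) (hx : x = l.prod • v) :
    ∃ p : T.Walk v x, p.IsPath ∧ p.length = l.length ∧ ∀ a ∈ l.head?, p.snd = a • v := by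
  induction l generalizing x with
  | nil =>
    obtain rfl : x = v := by simpa using hx
    exact ⟨SimpleGraph.Walk.nil, by simp⟩
  | cons g l ih =>
    rw [List.isChain_cons] at hchain
    obtain ⟨p, hp, hlen, hsnd⟩ :=
      ih (fun a ha => hadj a (List.mem_cons_of_mem _ ha)) hchain.2 (l.prod • v) rfl
    obtain rfl : x = g • l.prod • v := by simpa [mul_smul] using hx
    have hg : T.Adj v (g • v) := hadj g List.mem_cons_self
    let f : T →g T := ⟨(g • ·), fun {a b} hab => hsimp g a b hab⟩
    let q : T.Walk (g • v) (g • l.prod • v) := p.map f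
    have hq : q.IsPath := hp.map (MulAction.injective g)
    have hv : v ∉ q.support := by
      intro hmem
      have hback : v = g • p.snd := by
        have := hT.eq_snd_of_adj_start hq hg.symm hmem
        rwa [SimpleGraph.Walk.snd, SimpleGraph.Walk.getVert_map] at this
      cases l with
      | nil =>
        rw [SimpleGraph.Walk.snd, SimpleGraph.Walk.getVert_of_length_le p (hlen.trans_le zero_le_one)]
          at hback
        exact hg.ne (by simpa using hback)
      | cons b l =>
        rw [hsnd b rfl, ← mul_smul] at hback
        exact hchain.1 b rfl hback.symm
    refine ⟨SimpleGraph.Walk.cons hg q, hq.cons hv, ?_, ?_⟩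
    · exact congrArg (· + 1) ((SimpleGraph.Walk.length_map f p).trans hlen)
    · simp

/-- A nonempty product of non-backtracking letters moves the base vertex. -/
theorem SimpleGraph.IsAcyclic.prod_smul_ne {G V : Type*} [Group G] {T : SimpleGraph V}
    (hT : T.IsAcyclic) [MulAction G V]
    (hsimp : ∀ (g : G) (u v : V), T.Adj u v → T.Adj (g • u) (g • v)) (v : V) {l : List G}
    (hl : l ≠ []) (hadj : ∀ g ∈ l, T.Adj v (g • v))
    (hchain : l.IsChain fun a b => (a * b) • v ≠ v) : l.prod • v ≠ v := by
  intro heq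
  obtain ⟨p, hp, hlen, -⟩ := hT.exists_isPath_prod_smul hsimp v l hadj hchain v heq.symm
  rw [SimpleGraph.Walk.length_eq_zero_iff.2 (SimpleGraph.Walk.isPath_iff_nil.1 hp)] at hlen
  exact hl (List.length_eq_zero_iff.1 hlen.symm)

/-- A homomorphism from an HNN extension is injective if it is injective on the base group and
sends no reduced word involving the stable letter to `1`. -/
theorem HNNExtension.injective_of_reducedWord {H K : Type*} [Group H] [Group K]
    {A B : Subgroup H} {φ : A ≃* B} (F : HNNExtension H A B φ →* K)
    (hof : ∀ x : H, F (of x) = 1 → x = 1)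
    (hword : ∀ w : NormalWord.ReducedWord H A B, w.toList ≠ [] → F (w.prod φ) ≠ 1) :
    Function.Injective F := by
  rw [injective_iff_map_eq_one]
  intro x hx
  obtain ⟨d⟩ := NormalWord.TransversalPair.nonempty H A B
  obtain ⟨w, rfl⟩ := (NormalWord.equiv φ d).symm.surjective x
  change F (w.prod φ) = 1 at hx
  change w.prod φ = 1
  have hnil : w.toList = [] := by_contra fun hne => hword w.toReducedWord hne hx
  have hprod : w.prod φ = of w.head := by simp [NormalWord.ReducedWord.prod, hnil]
  rw [hprod] at hx ⊢
  rw [hof _ hx, map_one]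

/-- Suppose `h` moves `v` to a neighbour in a tree on which `G` acts without inversions, and `K`
fixes `v`. If `A` contains all of `K ∩ h⁻¹ Stab(v) h` and `B` contains all of `K ∩ Stab(h • v)`,
then the canonical map to `G` from the HNN extension of `K` along conjugation by `h` is
injective. -/
theorem HNNExtension.exists_injective_of_smul_adj {G V : Type*} [Group G] {T : SimpleGraph V}
    (hT : T.IsAcyclic) [MulAction G V]
    (hsimp : ∀ (g : G) (u v : V), T.Adj u v → T.Adj (g • u) (g • v))
    (hninv : ∀ (g : G) (u v : V), T.Adj u v → ¬(g • u = v ∧ g • v = u))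
    {v : V} {h : G} (hvw : T.Adj v (h • v)) {K : Subgroup G} (hK : ∀ g ∈ K, g • v = v)
    {A B : Subgroup K} (φ : A ≃* B) (hφ : ∀ a, ((φ a : K) : G) = h * ((a : K) : G) * h⁻¹)
    (hA : ∀ g : K, (h * g * h⁻¹) • v = v → g ∈ A)
    (hB : ∀ g : K, (g : G) • h • v = h • v → g ∈ B) :
    ∃ F : HNNExtension K A B φ →* G,
      (∀ x : K, F (of x) = (x : G)) ∧ F t = h ∧ Function.Injective F := by
  have hback (u u' : ℤˣ) (g : K) (hg : (h ^ (u : ℤ) * g * h ^ (u' : ℤ)) • v = v) :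
      g ∈ toSubgroup A B u ∧ u ≠ u' := by
    have hgv := hK g g.2
    rcases Int.units_eq_one_or u with rfl | rfl <;> rcases Int.units_eq_one_or u' with rfl | rfl
    · refine (hninv (h * g) v (h • v) hvw ⟨?_, ?_⟩).elim
      · rw [mul_smul, hgv]
      · simpa [mul_smul] using hg
    · exact ⟨hA g (by simpa using hg), by decide⟩
    · refine ⟨hB g ?_, by decide⟩
      simpa [mul_smul, inv_smul_eq_iff] using hg
    · refine (hninv (g * h⁻¹) v (h • v) hvw ⟨?_, ?_⟩).elim
      · simpa [mul_smul, inv_smul_eq_iff] using hg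
      · rw [mul_smul, inv_smul_smul, hgv]
  have hadj (u : ℤˣ) (g : K) : T.Adj v ((h ^ (u : ℤ) * (g : G)) • v) := by
    rw [mul_smul, hK g g.2]
    rcases Int.units_eq_one_or u with rfl | rfl
    · simpa using hvw
    · have := hsimp h⁻¹ v (h • v) hvw
      rw [inv_smul_smul] at this
      simpa using this.symm
  obtain ⟨F, hFof, hFt⟩ :
      ∃ F : HNNExtension K A B φ →* G, (∀ x : K, F (of x) = (x : G)) ∧ F t = h :=
    ⟨lift K.subtype h fun a => by simp [hφ, mul_assoc], fun x => lift_of _ _ _ x, lift_t _ _ _⟩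
  refine ⟨F, hFof, hFt, ?_⟩
  refine injective_of_reducedWord F (fun x hx => ?_) fun r hne hr => ?_
  · simpa [hFof] using hx
  · let l : List G := r.toList.map fun x => h ^ (x.1 : ℤ) * (x.2 : G)
    have hprod : (r.head : G) * l.prod = 1 := by
      simpa [NormalWord.ReducedWord.prod, map_list_prod, hFof, hFt, l, Function.comp_def] using hr
    refine hT.prod_smul_ne hsimp v (l := l) (by simpa [l] using hne) ?_ ?_ ?_
    · simp only [l, List.mem_map]
      rintro _ ⟨x, -, rfl⟩
      exact hadj _ _
    · refine (List.isChain_map _).2 (r.chain.imp fun a b hab heq => ?_)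
      rw [← mul_assoc, mul_smul, hK b.2 b.2.2] at heq
      obtain ⟨hmem, hne'⟩ := hback _ _ _ heq
      exact hne' (hab hmem)
    · rw [eq_inv_of_mul_eq_one_right hprod]
      exact hK _ (inv_mem r.head.2)

/-- **Subgroups generated by a vertex group and an edge-translating element** (Proposition on
controlled splittings, case (3)).  Let `G` act simplicially without inversions on a tree,
let `e = {v,w}` be an edge, `G_v`, `G_w` subgroups fixing `v`, `w`, and `h ∈ G` with
`h • v = w` and `h⁻¹ G_w h = G_v`.  Suppose `C := G_v ∩ Stab(e) = G_w ∩ Stab(e)`.  Then the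
canonical homomorphism into `G` from the HNN extension of `G_v` along the isomorphism
`h⁻¹Ch → C`, `k ↦ hkh⁻¹`, sending the stable letter to `h` and `G_v` to itself, is
injective; in particular `⟨G_v ∪ {h}⟩` is isomorphic to this HNN extension. -/
theorem hnn_extension_of_vertex_group_embeds
    {G V : Type*} [Group G] (T : SimpleGraph V) (hT : T.IsTree)
    [MulAction G V]
    (hsimp : ∀ (g : G) (u v : V), T.Adj u v → T.Adj (g • u) (g • v))
    (hninv : ∀ (g : G) (u v : V), T.Adj u v → ¬(g • u = v ∧ g • v = u))
    (v w : V) (hvw : T.Adj v w)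
    (Gv Gw : Subgroup G)
    (hGv : ∀ g ∈ Gv, g • v = v) (hGw : ∀ g ∈ Gw, g • w = w)
    (h : G) (hhv : h • v = w)
    (hconj : ∀ x : G, x ∈ Gw ↔ h⁻¹ * x * h ∈ Gv)
    (hC : Gv ⊓ (MulAction.stabilizer G v ⊓ MulAction.stabilizer G w) =
          Gw ⊓ (MulAction.stabilizer G v ⊓ MulAction.stabilizer G w))
    (φ : ((Subgroup.map (MulAut.conj h⁻¹).toMonoidHom
            (Gv ⊓ (MulAction.stabilizer G v ⊓ MulAction.stabilizer G w))).subgroupOf Gv) ≃*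
         ((Gv ⊓ (MulAction.stabilizer G v ⊓ MulAction.stabilizer G w)).subgroupOf Gv))
    (hφ : ∀ a, ((φ a : Gv) : G) = h * ((a : Gv) : G) * h⁻¹) :
    ∃ F : HNNExtension Gv
        ((Subgroup.map (MulAut.conj h⁻¹).toMonoidHom
          (Gv ⊓ (MulAction.stabilizer G v ⊓ MulAction.stabilizer G w))).subgroupOf Gv)
        ((Gv ⊓ (MulAction.stabilizer G v ⊓ MulAction.stabilizer G w)).subgroupOf Gv)
        φ →* G,
      (∀ x : Gv, F (HNNExtension.of x) = (x : G)) ∧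
      F HNNExtension.t = h ∧
      Function.Injective F := by
  subst hhv
  refine HNNExtension.exists_injective_of_smul_adj hT.isAcyclic hsimp hninv hvw hGv φ hφ ?_ ?_
  · intro g hg
    have hgw : h * g * h⁻¹ ∈ Gw := (hconj _).2 (by simp [mul_assoc])
    refine Subgroup.mem_subgroupOf.2 (Subgroup.mem_map.2 ⟨h * g * h⁻¹, ?_, by simp [mul_assoc]⟩)
    rw [hC]
    exact ⟨hgw, hg, hGw _ hgw⟩
  · exact fun g hg => Subgroup.mem_subgroupOf.2 ⟨g.2, hGv g g.2, hg⟩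
end

section
/- Let p ≥ 2 and let F = ℤ * ℤ/p be the free product of an infinite cyclic group with generator s and a cyclic group of order p with generator x. For every w ∈ F, either the pair (s, w(xs)w⁻¹) freely generates a free subgroup of rank 2 of F, or there exists an integer k such that w(xs)w⁻¹ = s^k (xs) s^{-k}. -/
/-- The free product `ℤ * ℤ/p`, presented as `⟨s, x | xᵖ⟩` with `s` indexed by `false`
and `x` indexed by `true`. -/
def ZFreeProdZMod (p : ℕ) : Type :=
  PresentedGroup ({FreeGroup.of true ^ p} : Set (FreeGroup Bool))

instance (p : ℕ) : Group (ZFreeProdZMod p) := by unfold ZFreeProdZMod; infer_instance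

/-- The generator `s` of the infinite cyclic factor of `ℤ * ℤ/p`. -/
def Fs (p : ℕ) : ZFreeProdZMod p := PresentedGroup.of false
/-- The generator `x` of the order-`p` factor of `ℤ * ℤ/p`. -/
def Fx (p : ℕ) : ZFreeProdZMod p := PresentedGroup.of true

/-- `h g` is the exponent of the first letter of `g` if `g` starts with a power of `s`, and `0`
otherwise, in a group `G` which is the free product of its subgroups generated by `s` and `x`,
with `s` of infinite order. -/
structure IsHeadExponent {G : Type} [Group G] (s x : G) (h : G → ℤ) : Prop where
  zpow_mul (n : ℤ) (g : G) : h (s ^ n * g) = n + h g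
  zpow_mul_eq_zero (n : ℤ) (g : G) (hn : x ^ n ≠ 1) (hg : h g ≠ 0) : h (x ^ n * g) = 0
  zpow_eq_zero (n : ℤ) : h (x ^ n) = 0
  ne_one : x ≠ 1
  induction (P : G → Prop) (one : P 1) (zpow_mul_right : ∀ (n : ℤ) (g : G), P g → P (x ^ n * g))
    (zpow_mul_left : ∀ (n : ℤ) (g : G), n ≠ 0 → h g = 0 → P g → P (s ^ n * g)) (g : G) : P g

namespace IsHeadExponent

variable {G : Type} [Group G] {s x : G} {h : G → ℤ}

theorem one_eq_zero (H : IsHeadExponent s x h) : h 1 = 0 := by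
  simpa using H.zpow_eq_zero 0

theorem zpow_eq (H : IsHeadExponent s x h) (n : ℤ) : h (s ^ n) = n := by
  simpa [H.one_eq_zero] using H.zpow_mul n 1

theorem mul_eq_zero (H : IsHeadExponent s x h) {g : G} (hg : h g ≠ 0) : h (x * g) = 0 := by
  simpa using H.zpow_mul_eq_zero 1 g (by simpa using H.ne_one) hg

theorem inv_mul_eq_zero (H : IsHeadExponent s x h) {g : G} (hg : h g ≠ 0) :
    h (x⁻¹ * g) = 0 := by
  simpa using H.zpow_mul_eq_zero (-1) g (by simpa using H.ne_one) hg

theorem mul_left (H : IsHeadExponent s x h) (g : G) : h (s * g) = 1 + h g := by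
  simpa using H.zpow_mul 1 g

theorem inv_mul_left (H : IsHeadExponent s x h) (g : G) : h (s⁻¹ * g) = -1 + h g := by
  simpa using H.zpow_mul (-1) g

/-- Up to a power of `x * s` on the left, an element starts neither with a negative power of `s`
nor with `x` followed by a positive power of `s`. -/
theorem exists_zpow_mul_head (H : IsHeadExponent s x h) (g : G) :
    ∃ i : ℤ, 0 ≤ h ((x * s) ^ i * g) ∧ h (x⁻¹ * ((x * s) ^ i * g)) ≤ 0 := by
  suffices ∀ n : ℤ, ∃ i : ℤ, 0 ≤ h ((x * s) ^ i * (x ^ n * g)) ∧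
      h (x⁻¹ * ((x * s) ^ i * (x ^ n * g))) ≤ 0 by simpa using this 0
  induction g using H.induction with
  | one =>
    intro n
    refine ⟨0, ?_, ?_⟩
    · simp [H.zpow_eq_zero]
    · have := H.zpow_eq_zero (-1 + n)
      rw [zpow_add, zpow_neg_one] at this
      simp [this]
  | zpow_mul_right k g ih =>
    intro n
    simpa [zpow_add, mul_assoc] using ih (n + k)
  | zpow_mul_left k g hk hg ih =>
    intro n
    have hsk : h (s ^ k * g) = k := by rw [H.zpow_mul, hg, add_zero]
    have step : ∀ i : ℤ, ∀ a b : G, (x * s) ^ i * a = b →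
        (∃ j : ℤ, 0 ≤ h ((x * s) ^ j * b) ∧ h (x⁻¹ * ((x * s) ^ j * b)) ≤ 0) →
        ∃ j : ℤ, 0 ≤ h ((x * s) ^ j * a) ∧ h (x⁻¹ * ((x * s) ^ j * a)) ≤ 0 := by
      rintro i a b rfl ⟨j, hj⟩
      exact ⟨j + i, by simpa [zpow_add, mul_assoc] using hj⟩
    by_cases h0 : x ^ n = 1
    · rw [h0, one_mul]
      rcases lt_trichotomy k (-1) with hk1 | rfl | hk1
      · refine ⟨1, ?_, ?_⟩
        · rw [zpow_one, mul_assoc, H.mul_eq_zero]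
          rw [H.mul_left]; omega
        · rw [zpow_one, mul_assoc, inv_mul_cancel_left, H.mul_left]; omega
      · exact step 1 _ (x * g) (by simp [mul_assoc]) (by simpa using ih 1)
      · refine ⟨0, ?_, ?_⟩
        · rw [zpow_zero, one_mul]; omega
        · rw [zpow_zero, one_mul, H.inv_mul_eq_zero]; omega
    by_cases h1 : x ^ n = x
    · rw [h1]
      rcases lt_trichotomy k 1 with hk1 | rfl | hk1
      · refine ⟨0, ?_, ?_⟩
        · rw [zpow_zero, one_mul, H.mul_eq_zero]; omega
        · rw [zpow_zero, one_mul, inv_mul_cancel_left]; omega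
      · exact step (-1) _ g (by simp [mul_assoc]) (by simpa using ih 0)
      · refine step (-1) _ (s ^ (k - 1) * g) ?_ ?_
        · rw [sub_eq_neg_add, zpow_add, zpow_neg_one, zpow_neg_one]
          simp [mul_assoc]
        have hk' : h (s ^ (k - 1) * g) = k - 1 := by rw [H.zpow_mul, hg, add_zero]
        refine ⟨0, ?_, ?_⟩
        · rw [zpow_zero, one_mul]; omega
        · rw [zpow_zero, one_mul, H.inv_mul_eq_zero]; omega
    · refine ⟨0, ?_, ?_⟩
      · rw [zpow_zero, one_mul, H.zpow_mul_eq_zero n _ h0 (by omega)]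
      · rw [zpow_zero, one_mul, ← mul_assoc, ← zpow_neg_one, ← zpow_add,
          H.zpow_mul_eq_zero _ _ _ (by omega)]
        rw [zpow_add, zpow_neg_one]
        exact fun e => h1 (inv_mul_eq_one.mp e).symm

/-- After multiplication on the right by a suitable power of `s`, the first letter of `x ^ b * g`
no longer changes on further multiplication on the right by an element starting with `s`,
unless `x ^ b * g` is a power of `s`. -/
theorem exists_mul_zpow_stable (H : IsHeadExponent s x h) (g : G) :
    ∃ j : ℤ, ∀ b : ℤ, (∃ k : ℤ, x ^ b * g = s ^ k) ∨
      ∀ u, h u ≠ 0 → h (x ^ b * g * s ^ j * u) = h (x ^ b * g * s ^ j) := by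
  have base : ∀ n : ℤ, ∃ j : ℤ, ∀ b : ℤ, (∃ k : ℤ, x ^ b * s ^ n = s ^ k) ∨
      ∀ u, h u ≠ 0 → h (x ^ b * s ^ n * s ^ j * u) = h (x ^ b * s ^ n * s ^ j) := by
    refine fun n => ⟨-n, fun b => ?_⟩
    by_cases hb : x ^ b = 1
    · exact .inl ⟨n, by rw [hb, one_mul]⟩
    · refine .inr fun u hu => ?_
      rw [mul_assoc (x ^ b), ← zpow_add, add_neg_cancel, zpow_zero, mul_one,
        H.zpow_eq_zero, H.zpow_mul_eq_zero b u hb hu]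
  induction g using H.induction with
  | one => simpa using base 0
  | zpow_mul_right n g ih =>
    obtain ⟨j, hj⟩ := ih
    exact ⟨j, fun b => by simpa only [zpow_add, mul_assoc] using hj (b + n)⟩
  | zpow_mul_left n g hn hg ih =>
    obtain ⟨j, hj⟩ := ih
    rcases hj 0 with ⟨k, hk⟩ | hs
    · obtain rfl : g = s ^ k := by simpa using hk
      simpa only [zpow_add] using base (n + k)
    simp only [zpow_zero, one_mul] at hs
    have hgj : h (g * s ^ j) = 0 := by
      by_cases hj0 : j = 0
      · simpa [hj0] using hg
      · rw [← hs (s ^ (-j)) (by rw [H.zpow_eq]; omega)]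
        simpa [mul_assoc] using hg
    refine ⟨j, fun b => ?_⟩
    have h1 : h (s ^ n * (g * s ^ j)) = n := by rw [H.zpow_mul, hgj, add_zero]
    have h2 : ∀ u, h u ≠ 0 → h (s ^ n * (g * s ^ j * u)) = n := fun u hu => by
      rw [H.zpow_mul, hs u hu, hgj, add_zero]
    by_cases hb : x ^ b = 1
    · refine .inr fun u hu => ?_
      have := h2 u hu
      simp only [hb, one_mul, mul_assoc] at this h1 ⊢
      rw [this, h1]
    · refine .inr fun u hu => ?_
      have h3 := H.zpow_mul_eq_zero b _ hb (by rwa [h1] : h (s ^ n * (g * s ^ j)) ≠ 0)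
      have h4 := H.zpow_mul_eq_zero b _ hb (by rwa [h2 u hu] : h (s ^ n * (g * s ^ j * u)) ≠ 0)
      simp only [mul_assoc] at h3 h4 ⊢
      rw [h3, h4]

/-- Every element outside the double coset `⟨x * s⟩⟨s⟩` has a representative modulo that pair
of subgroups which, multiplied on the right by any element starting with `s`, starts neither with
a negative power of `s` nor with `x` followed by a positive power of `s`. -/
theorem exists_mul_mul_head (H : IsHeadExponent s x h) (g : G)
    (hg : ∀ i k : ℤ, g ≠ (x * s) ^ i * s ^ k) :
    ∃ i j : ℤ, ∀ u, h u ≠ 0 → 0 ≤ h ((x * s) ^ i * g * s ^ j * u) ∧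
      h (x⁻¹ * ((x * s) ^ i * g * s ^ j * u)) ≤ 0 := by
  obtain ⟨i, hi1, hi2⟩ := H.exists_zpow_mul_head g
  obtain ⟨j, hj⟩ := H.exists_mul_zpow_stable ((x * s) ^ i * g)
  set v := (x * s) ^ i * g with hv
  have hgv : g = (x * s) ^ (-i) * v := by rw [hv, zpow_neg, inv_mul_cancel_left]
  have key : ∀ b : ℤ, (∀ k : ℤ, x ^ b * v ≠ s ^ k) →
      ∀ u, h u ≠ 0 → h (x ^ b * v * s ^ j * u) = h (x ^ b * v) := by
    intro b hb u hu
    have hs := (hj b).resolve_left fun ⟨k, hk⟩ => hb k hk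
    rw [hs u hu]
    by_cases hj0 : j = 0
    · simp [hj0]
    · rw [← hs (s ^ (-j)) (by rw [H.zpow_eq]; omega)]
      simp [mul_assoc]
  have key0 := key 0 fun k hk => hg (-i) k (by rw [hgv, ← hk, zpow_zero, one_mul])
  have key1 := key (-1) fun k hk => hg (-i + 1) (k - 1) <| by
    rw [hgv, zpow_add, zpow_one, sub_eq_neg_add, zpow_add, ← hk]
    simp [mul_assoc]
  refine ⟨i, j, fun u hu => ⟨?_, ?_⟩⟩
  · have := key0 u hu
    simp only [zpow_zero, one_mul] at this
    rwa [this]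
  · have := key1 u hu
    rw [zpow_neg_one, mul_assoc, mul_assoc, ← mul_assoc v] at this
    rwa [this]

/-- If `g * u` starts neither with a negative power of `s` nor with `x` followed by a positive
power of `s` whenever `u` starts with `s`, then `s` and the conjugate of `x * s` by `s ^ j * g⁻¹`
play ping-pong. -/
theorem injective_lift (H : IsHeadExponent s x h) (g : G) (j : ℤ)
    (hg : ∀ u, h u ≠ 0 → 0 ≤ h (g * u) ∧ h (x⁻¹ * (g * u)) ≤ 0) :
    Function.Injective (FreeGroup.lift (fun i : Bool =>
      if i then s else s ^ j * g⁻¹ * (x * s) * (s ^ j * g⁻¹)⁻¹)) := by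
  have hs (u : G) : h (s ^ (-j) * (s * u)) = 1 + h (s ^ (-j) * u) := by
    rw [← H.mul_left, ← mul_assoc, ← mul_assoc, (Commute.refl s).zpow_left]
  have hs' (u : G) : h (s ^ (-j) * (s⁻¹ * u)) = -1 + h (s ^ (-j) * u) := by
    rw [← H.inv_mul_left, ← mul_assoc, ← mul_assoc, ((Commute.refl s).inv_right.zpow_left _).eq]
  have hs1 : h s = 1 := by simpa using H.zpow_eq 1
  have hdisj (u : G) (hu : h (s ^ (-j) * u) ≠ 0) := hg _ hu
  have hP (u : G) (hu : 0 < h (x⁻¹ * u)) : h u = 0 := by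
    simpa using H.mul_eq_zero hu.ne'
  refine FreeGroup.injective_lift_of_ping_pong (α := G) _
    (X := fun i : Bool => if i then {u | 0 < h (s ^ (-j) * u)}
      else {u | 0 < h (x⁻¹ * (g * (s ^ (-j) * u)))})
    (Y := fun i : Bool => if i then {u | h (s ^ (-j) * u) < 0}
      else {u | h (g * (s ^ (-j) * u)) < 0})
    ?_ ?_ ?_ ?_ ?_ ?_
  · rintro (_ | _)
    · refine ⟨s ^ j * g⁻¹ * (x * s), ?_⟩
      simp [mul_assoc, hs1]
    · refine ⟨s ^ j * s, ?_⟩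
      simp [hs1]
  · rintro (_ | _) (_ | _) hne <;> try exact absurd rfl hne
    all_goals
      refine Set.disjoint_left.mpr fun u hu hu' => ?_
      simp only [Bool.false_eq_true, reduceIte, Set.mem_ofPred_eq] at hu hu'
      have h1 := hP (g * (s ^ (-j) * u))
      have h2 := hdisj u
      omega
  · rintro (_ | _) (_ | _) hne <;> try exact absurd rfl hne
    all_goals
      refine Set.disjoint_left.mpr fun u hu hu' => ?_
      simp only [Bool.false_eq_true, reduceIte, Set.mem_ofPred_eq] at hu hu'
      have h1 := hP (g * (s ^ (-j) * u))
      have h2 := hdisj u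
      omega
  · rintro (_ | _) (_ | _)
    all_goals
      refine Set.disjoint_left.mpr fun u hu hu' => ?_
      simp only [Bool.false_eq_true, reduceIte, Set.mem_ofPred_eq] at hu hu'
      have h1 := hP (g * (s ^ (-j) * u))
      have h2 := hdisj u
      omega
  · rintro (_ | _) _ ⟨u, hu, rfl⟩
    · replace hu : ¬ h (g * (s ^ (-j) * u)) < 0 := hu
      have := H.mul_left (g * (s ^ (-j) * u))
      simp only [zpow_neg] at this hu
      simp [mul_assoc, this]
      omega
    · replace hu : ¬ h (s ^ (-j) * u) < 0 := hu
      change 0 < h (s ^ (-j) * (s * u))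
      rw [hs]; omega
  · rintro (_ | _) _ ⟨u, hu, rfl⟩
    · replace hu : ¬ 0 < h (x⁻¹ * (g * (s ^ (-j) * u))) := hu
      have := H.inv_mul_left (x⁻¹ * (g * (s ^ (-j) * u)))
      simp only [zpow_neg] at this hu
      simp [mul_assoc, this]
      omega
    · replace hu : ¬ 0 < h (s ^ (-j) * u) := hu
      change h (s ^ (-j) * (s⁻¹ * u)) < 0
      rw [hs']; omega

/-- For every `w`, either `s` and `w * (x * s) * w⁻¹` freely generate a free group, or
`w * (x * s) * w⁻¹` is the conjugate of `x * s` by a power of `s`. -/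
theorem conj_free_or_power (H : IsHeadExponent s x h) (w : G) :
    Function.Injective (FreeGroup.lift (fun i : Bool =>
        if i then s else w * (x * s) * w⁻¹) : FreeGroup Bool →* G) ∨
      ∃ k : ℤ, w * (x * s) * w⁻¹ = s ^ k * (x * s) * s ^ (-k) := by
  by_cases hw : ∃ i k : ℤ, w⁻¹ = (x * s) ^ i * s ^ k
  · obtain ⟨i, k, hw⟩ := hw
    refine .inr ⟨-k, ?_⟩
    have hc : (x * s) ^ (-i) * (x * s) * (x * s) ^ i = x * s := by
      rw [← zpow_add_one, ← zpow_add]; simp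
    rw [← inv_inv w, hw]
    simp only [neg_neg, mul_inv_rev, ← zpow_neg]
    calc _ = s ^ (-k) * ((x * s) ^ (-i) * (x * s) * (x * s) ^ i) * s ^ k := by
          simp only [mul_assoc]
      _ = _ := by rw [hc]
  · push Not at hw
    obtain ⟨i, j, hij⟩ := H.exists_mul_mul_head w⁻¹ hw
    left
    convert H.injective_lift _ j hij using 5
    have hc : (x * s) ^ (-i) * (x * s) * (x * s) ^ i = x * s := by
      rw [← zpow_add_one, ← zpow_add]; simp
    have hw' : s ^ j * ((x * s) ^ i * w⁻¹ * s ^ j)⁻¹ = w * (x * s) ^ (-i) := by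
      simp [mul_assoc]
    rw [hw', mul_inv_rev, ← zpow_neg, neg_neg]
    calc _ = w * ((x * s) ^ (-i) * (x * s) * (x * s) ^ i) * w⁻¹ := by rw [hc]
      _ = _ := by simp only [mul_assoc]

end IsHeadExponent

/-- The homomorphism from the cyclic group of order `n` sending its generator to an element
whose `n`-th power is trivial. -/
def zmodPowersHom {G : Type*} [Group G] (n : ℕ) (g : G) (hg : g ^ n = 1) :
    Multiplicative (ZMod n) →* G :=
  AddMonoidHom.toMultiplicativeLeft
    (ZMod.lift n ⟨zmultiplesHom (Additive G) (.ofMul g), by simp [← ofMul_pow, hg]⟩)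

theorem zmodPowersHom_ofAdd_one {G : Type*} [Group G] (n : ℕ) (g : G) (hg : g ^ n = 1) :
    zmodPowersHom n g hg (.ofAdd 1) = g := by
  have := ZMod.lift_coe n
    (⟨zmultiplesHom (Additive G) (.ofMul g), by simp [← ofMul_pow, hg]⟩ :
      {f : ℤ →+ Additive G // f n = 0}) 1
  rw [Int.cast_one] at this
  exact congrArg Additive.toMul (this.trans (one_zsmul _))

/-- The two cyclic factors of `ℤ * ℤ/p`, written multiplicatively. -/
abbrev ZFreeProdZMod.Factor (p : ℕ) (i : Bool) : Type :=
  Multiplicative (ZMod (bif i then p else 0))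

namespace ZFreeProdZMod

open Monoid CoprodI

theorem Fx_pow (p : ℕ) : Fx p ^ p = 1 :=
  PresentedGroup.one_of_mem (rels := {FreeGroup.of true ^ p}) rfl

/-- The generator of a cyclic factor of `ℤ * ℤ/p`. -/
def gen (p : ℕ) (i : Bool) : Factor p i := .ofAdd 1

theorem exists_eq_gen_zpow {p : ℕ} {i : Bool} (m : Factor p i) : ∃ n : ℤ, m = gen p i ^ n := by
  obtain ⟨n, hn⟩ := ZMod.intCast_surjective m.toAdd
  refine ⟨n, ?_⟩
  rw [gen, ← ofAdd_zsmul, zsmul_one, hn]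
  rfl

theorem gen_true_pow (p : ℕ) : gen p true ^ p = 1 := by
  rw [gen, ← ofAdd_nsmul, nsmul_one]
  exact congrArg Multiplicative.ofAdd (ZMod.natCast_self p)

/-- The map from `ℤ * ℤ/p` to the free product of its factors. -/
def toCoprodI (p : ℕ) : ZFreeProdZMod p →* CoprodI (Factor p) :=
  PresentedGroup.toGroup (f := fun i => of (gen p i)) (by
    rintro _ rfl
    rw [map_pow, FreeGroup.lift_apply_of, ← map_pow, gen_true_pow, map_one])

theorem toCoprodI_Fs (p : ℕ) : toCoprodI p (Fs p) = of (gen p false) :=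
  PresentedGroup.toGroup.of _

theorem toCoprodI_Fx (p : ℕ) : toCoprodI p (Fx p) = of (gen p true) :=
  PresentedGroup.toGroup.of _

/-- The exponent of `s` at the head of the normal form of an element of `ℤ * ℤ/p`. -/
def headExponent (p : ℕ) (g : ZFreeProdZMod p) : ℤ :=
  (Word.equivPair false (toCoprodI p g • (Word.empty : Word (Factor p)))).head.toAdd

/-- The inverse of `toCoprodI`. -/
def ofCoprodI (p : ℕ) : CoprodI (Factor p) →* ZFreeProdZMod p :=
  CoprodI.lift fun
    | false => zmodPowersHom 0 (Fs p) (pow_zero _)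
    | true => zmodPowersHom p (Fx p) (Fx_pow p)

theorem ofCoprodI_gen_false (p : ℕ) : ofCoprodI p (of (gen p false)) = Fs p :=
  (lift_of _ _).trans (zmodPowersHom_ofAdd_one ..)

theorem ofCoprodI_gen_true (p : ℕ) : ofCoprodI p (of (gen p true)) = Fx p :=
  (lift_of _ _).trans (zmodPowersHom_ofAdd_one ..)

theorem ofCoprodI_toCoprodI (p : ℕ) (g : ZFreeProdZMod p) : ofCoprodI p (toCoprodI p g) = g := by
  suffices (ofCoprodI p).comp (toCoprodI p) = MonoidHom.id _ from DFunLike.congr_fun this g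
  refine PresentedGroup.ext ?_
  rintro (_ | _)
  · exact (congrArg _ (toCoprodI_Fs p)).trans (ofCoprodI_gen_false p)
  · exact (congrArg _ (toCoprodI_Fx p)).trans (ofCoprodI_gen_true p)

theorem toCoprodI_ofCoprodI (p : ℕ) (c : CoprodI (Factor p)) :
    toCoprodI p (ofCoprodI p c) = c := by
  suffices (toCoprodI p).comp (ofCoprodI p) = MonoidHom.id _ from DFunLike.congr_fun this c
  refine CoprodI.ext_hom _ _ fun i => MonoidHom.ext fun m => ?_
  obtain ⟨n, rfl⟩ := exists_eq_gen_zpow m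
  cases i
  · simp [ofCoprodI_gen_false, toCoprodI_Fs]
  · simp [ofCoprodI_gen_true, toCoprodI_Fx]

theorem head_equivPair_smul_eq_one {p : ℕ} (m : Factor p true) (u : Word (Factor p))
    (hm : m ≠ 1) (hu : u.fstIdx ≠ some true) :
    (Word.equivPair false (of m • u)).head = 1 := by
  rw [← Word.cons_eq_smul (h1 := hu) (h2 := hm), Word.equivPair_eq_of_fstIdx_ne]
  simp

theorem isHeadExponent {p : ℕ} (hp : 2 ≤ p) :
    IsHeadExponent (Fs p) (Fx p) (headExponent p) where
  zpow_mul n g := by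
    have hn : (gen p false ^ n).toAdd = n := by
      rw [gen, ← ofAdd_zsmul, zsmul_one]
      exact Int.cast_id
    rw [headExponent, map_mul, map_zpow, toCoprodI_Fs, mul_smul, ← map_zpow,
      Word.equivPair_smul_same]
    exact congrArg (· + headExponent p g) hn
  zpow_mul_eq_zero n g hn hg := by
    rw [headExponent, map_mul, map_zpow, toCoprodI_Fx, mul_smul, ← map_zpow,
      head_equivPair_smul_eq_one]
    · rfl
    · intro h
      apply hn
      rw [← ofCoprodI_gen_true, ← map_zpow, ← map_zpow, h, map_one, map_one]
    · intro h
      apply hg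
      rw [headExponent, Word.equivPair_eq_of_fstIdx_ne (by simp [h])]
      rfl
  zpow_eq_zero n := by
    rw [headExponent, map_zpow, toCoprodI_Fx, ← map_zpow]
    by_cases hn : gen p true ^ n = 1
    · rw [hn, map_one, one_smul, Word.equivPair_eq_of_fstIdx_ne (by simp [Word.fstIdx])]
      rfl
    · rw [head_equivPair_smul_eq_one _ _ hn (by simp [Word.fstIdx])]
      rfl
  ne_one h := by
    have : Fact (1 < p) := ⟨hp⟩
    have h1 : of (gen p true) = 1 := by rw [← toCoprodI_Fx, h, map_one]
    exact one_ne_zero (α := ZMod p) (of_injective (M := Factor p) true (h1.trans (map_one _).symm))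
  induction P one hx hs g := by
    have hprod (u : Word (Factor p)) : u.prod • Word.empty = u := Word.equiv.apply_symm_apply u
    suffices ∀ u : Word (Factor p), P (ofCoprodI p u.prod) by
      have := this (Word.equiv (toCoprodI p g))
      rwa [show (Word.equiv (toCoprodI p g)).prod = toCoprodI p g from
        Word.equiv.symm_apply_apply _, ofCoprodI_toCoprodI] at this
    intro u
    induction u using Word.consRecOn with
    | empty => simpa using one
    | cons i m u h1 h2 ih =>
      obtain ⟨n, rfl⟩ := exists_eq_gen_zpow m
      rw [Word.prod_cons, map_mul, map_zpow, map_zpow]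
      cases i
      · rw [ofCoprodI_gen_false]
        refine hs n _ (fun h => h2 (by rw [h, zpow_zero])) ?_ ih
        rw [headExponent, toCoprodI_ofCoprodI, hprod, Word.equivPair_eq_of_fstIdx_ne h1]
        rfl
      · rw [ofCoprodI_gen_true]
        exact hx n _ ih

end ZFreeProdZMod

/-- **Conjugates of `xs` against `s` in `ℤ * ℤ/p`.**  For every `w`, either the pair
`(s, w(xs)w⁻¹)` freely generates a free subgroup of rank 2, or `w(xs)w⁻¹ = sᵏ(xs)s⁻ᵏ`
for some integer `k`. -/
theorem zFreeProdZMod_conj_free_or_power (p : ℕ) (hp : 2 ≤ p) (w : ZFreeProdZMod p) :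
    Function.Injective
      (FreeGroup.lift (fun i : Bool =>
        if i then Fs p else w * (Fx p * Fs p) * w⁻¹) : FreeGroup Bool →* ZFreeProdZMod p) ∨
    ∃ k : ℤ, w * (Fx p * Fs p) * w⁻¹ = Fs p ^ k * (Fx p * Fs p) * Fs p ^ (-k) := by
  exact (ZFreeProdZMod.isHeadExponent hp).conj_free_or_power w
end

section
/- Let p ≥ 2 and b ≥ 1 be integers with gcd(p,b) = 1, and let G be the group with presentation ⟨s, x, f | sf = fs, xf = fx, x^p = f^b⟩. Then for all integers k and m, the intersection of the subgroup of G generated by {s f^k, x f^m} with the subgroup generated by f equals the subgroup generated by f^{b+pm}. -/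
/-- The fundamental group of a Seifert fibered space over the annulus with one cone point:
`⟨s, x, f | sf = fs, xf = fx, xᵖ = f^b⟩`, with `s, x, f` indexed by `0, 1, 2 : Fin 3`. -/
def SeifertAp (p b : ℕ) : Type :=
  PresentedGroup
    ({FreeGroup.of (0 : Fin 3) * FreeGroup.of 2 * (FreeGroup.of 0)⁻¹ * (FreeGroup.of 2)⁻¹,
      FreeGroup.of (1 : Fin 3) * FreeGroup.of 2 * (FreeGroup.of 1)⁻¹ * (FreeGroup.of 2)⁻¹,
      FreeGroup.of (1 : Fin 3) ^ p * (FreeGroup.of 2)⁻¹ ^ b} : Set (FreeGroup (Fin 3)))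

instance (p b : ℕ) : Group (SeifertAp p b) := by unfold SeifertAp; infer_instance

/-- The generator `s` of `SeifertAp p b`. -/
def Ss (p b : ℕ) : SeifertAp p b := PresentedGroup.of 0
/-- The generator `x` of `SeifertAp p b`. -/
def Sx (p b : ℕ) : SeifertAp p b := PresentedGroup.of 1
/-- The generator `f` (the fiber) of `SeifertAp p b`. -/
def Sf (p b : ℕ) : SeifertAp p b := PresentedGroup.of 2

theorem commute_Sx_Sf (p b : ℕ) : Commute (Sx p b) (Sf p b) := by
  have h : Sx p b * Sf p b * (Sx p b)⁻¹ * (Sf p b)⁻¹ = 1 :=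
    PresentedGroup.one_of_mem (by simp)
  simpa [commute_iff_eq, mul_inv_eq_one, mul_inv_eq_iff_eq_mul] using h

theorem Sx_pow (p b : ℕ) : Sx p b ^ p = Sf p b ^ b := by
  have h : Sx p b ^ p * (Sf p b)⁻¹ ^ b = 1 :=
    PresentedGroup.one_of_mem (by simp)
  simpa [mul_inv_eq_one] using h

theorem Sx_mul_Sf_zpow_pow (p b : ℕ) (m : ℤ) :
    (Sx p b * Sf p b ^ m) ^ p = Sf p b ^ ((b : ℤ) + (p : ℤ) * m) := by
  rw [((commute_Sx_Sf p b).zpow_right m).mul_pow, Sx_pow, zpow_add, zpow_natCast, mul_comm (p : ℤ),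
    zpow_mul, zpow_natCast]

/-- The group `SeifertAp p b` maps to any commutative group containing elements `s`, `x`, `f`
with `xᵖ = f^b`. -/
theorem SeifertAp.exists_hom {A : Type*} [CommGroup A] {p b : ℕ} (s x f : A)
    (h : x ^ p = f ^ b) :
    ∃ φ : SeifertAp p b →* A, φ (Ss p b) = s ∧ φ (Sx p b) = x ∧ φ (Sf p b) = f := by
  refine ⟨PresentedGroup.toGroup (f := ![s, x, f]) ?_, PresentedGroup.toGroup.of _,
    PresentedGroup.toGroup.of _, PresentedGroup.toGroup.of _⟩
  rintro r (rfl | rfl | rfl)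
  · simp
  · simp
  · simp [h]

/-- **Intersection with the fiber subgroup.**  In the group
`G = ⟨s, x, f | sf = fs, xf = fx, xᵖ = f^b⟩` with `p ≥ 2`, `b ≥ 1`, `gcd(p,b) = 1`, for all
integers `k, m` the subgroup generated by `{s fᵏ, x fᵐ}` meets the subgroup generated
by `f` exactly in the subgroup generated by `f^(b + pm)`. -/
theorem seifertAp_two_generated_inter_fiber (p b : ℕ) (hp : 2 ≤ p) (hb : 1 ≤ b)
    (hcop : Nat.gcd p b = 1) (k m : ℤ) :
    Subgroup.closure {Ss p b * (Sf p b) ^ k, Sx p b * (Sf p b) ^ m} ⊓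
      Subgroup.closure {Sf p b} =
    Subgroup.closure {(Sf p b) ^ ((b : ℤ) + (p : ℤ) * m)} := by
  apply le_antisymm
  · rintro g ⟨hg, hgf⟩
    obtain ⟨j, rfl⟩ := Subgroup.mem_closure_singleton.1 hgf
    set n : ℤ := (b : ℤ) + (p : ℤ) * m with hn
    have hn0 : ((n : ℤ) : ZMod n.natAbs) = 0 :=
      (ZMod.intCast_zmod_eq_zero_iff_dvd _ _).2 (Int.natAbs_dvd.2 dvd_rfl)
    have hrel : (b : ZMod n.natAbs) + p * m = 0 := by
      rw [← hn0, hn]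
      push_cast
      rfl
    obtain ⟨φ, hs, hx, hf⟩ := SeifertAp.exists_hom (p := p) (b := b)
      (Multiplicative.ofAdd (-(k : ZMod n.natAbs))) (Multiplicative.ofAdd (-(m : ZMod n.natAbs)))
      (Multiplicative.ofAdd 1) (by
        simp only [← ofAdd_nsmul, nsmul_eq_mul]
        congr 1
        linear_combination -hrel)
    have hker : Subgroup.closure {Ss p b * Sf p b ^ k, Sx p b * Sf p b ^ m} ≤ φ.ker := by
      rw [Subgroup.closure_le]
      rintro _ (rfl | rfl) <;>
        simp [MonoidHom.mem_ker, hs, hx, hf, ← ofAdd_zsmul]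
    have hj : ((j : ℤ) : ZMod n.natAbs) = 0 := by
      have := hker hg
      rw [MonoidHom.mem_ker, map_zpow, hf, ← ofAdd_zsmul] at this
      simpa using this
    obtain ⟨c, rfl⟩ := Int.natAbs_dvd.1 ((ZMod.intCast_zmod_eq_zero_iff_dvd _ _).1 hj)
    exact Subgroup.mem_closure_singleton.2 ⟨c, (zpow_mul _ _ _).symm⟩
  · rw [Subgroup.closure_le, Set.singleton_subset_iff]
    refine ⟨?_, Subgroup.zpow_mem _ (Subgroup.mem_closure_singleton_self _) _⟩
    rw [← Sx_mul_Sf_zpow_pow]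
    exact Subgroup.pow_mem _ (Subgroup.subset_closure (by simp)) _
end
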